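/- Extrinsicity of the lightlike normal curvature (in L-coordinates): Let f : U₀ → 𝕃³ be a real analytic immersion on an open neighborhood U₀ of (0,0) ∈ ℝ² with ⟨f_u, f_v⟩ ≡ 0, E := ⟨f_u, f_u⟩ > 0, E(u,0) = 1 for all u, G := ⟨f_v, f_v⟩, G(u,0) = 0 and G_v(u,0) ≠ 0 for all u, and E_v(0,0) ≠ 0 (so the origin is a generic lightlike point of the first kind). Then there exist an open neighborhood U ⊆ U₀ of (0,0) and a real analytic immersion f̃ : U → 𝕃³ with the same first fundamental form as f (⟨f̃_u, f̃_u⟩ = E, ⟨f̃_u, f̃_v⟩ = 0, ⟨f̃_v, f̃_v⟩ = G on U) such that ⟨f̃_uu(0,0), f̃_uu(0,0)⟩ ≠ ⟨f_uu(0,0), f_uu(0,0)⟩; consequently, the lightlike normal curvatures at the origin, κ_N = −∛(G_v(0,0))·⟨f_uu(0,0), f_uu(0,0)⟩/E_v(0,0) for f and the analogous quantity for f̃, differ, so κ_N is not determined by the first fundamental form (it is an extrinsic invariant). -/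

import Mathlib

noncomputable section

/-- The Minkowski inner product of signature (+,+,−) on ℝ³. -/
def mink (x y : Fin 3 → ℝ) : ℝ := x 0 * y 0 + x 1 * y 1 - x 2 * y 2

/-- The Lorentzian vector product `v × w = S (v ×ₑ w)`, `S = diag(1,1,−1)`. -/
def lcross (v w : Fin 3 → ℝ) : Fin 3 → ℝ :=
  ![v 1 * w 2 - v 2 * w 1, v 2 * w 0 - v 0 * w 2, -(v 0 * w 1 - v 1 * w 0)]

/-- Partial derivative in the first coordinate direction. -/
def pu {E : Type*} [NormedAddCommGroup E] [NormedSpace ℝ E]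
    (f : ℝ × ℝ → E) (q : ℝ × ℝ) : E :=
  fderiv ℝ f q (1, 0)

/-- Partial derivative in the second coordinate direction. -/
def pv {E : Type*} [NormedAddCommGroup E] [NormedSpace ℝ E]
    (f : ℝ × ℝ → E) (q : ℝ × ℝ) : E :=
  fderiv ℝ f q (0, 1)

/-- The real cube root. -/
def cbrt (t : ℝ) : ℝ := if t < 0 then -((-t) ^ ((1 : ℝ) / 3)) else t ^ ((1 : ℝ) / 3)

open PowerSeries Filter Topology Finset
open scoped Nat ENNReal NNReal

/-- Formal power series in two variables `u`, `v`, seen as power series in `v` whose coefficients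
are power series in `u`. -/
abbrev BiSeries := ℝ⟦X⟧⟦X⟧

namespace BiSeries

/-- The coefficient of `u ^ j * v ^ k`. -/
def bc (j k : ℕ) (a : BiSeries) : ℝ := coeff j (coeff k a)

/-- The formal derivative in `u`. -/
def du (a : BiSeries) : BiSeries := PowerSeries.mk fun k => derivative ℝ (coeff k a)

/-- The formal derivative in `v`. -/
def dv (a : BiSeries) : BiSeries := derivative ℝ⟦X⟧ a

/-- The formal antiderivative in `v` without term of degree zero in `v`. -/
def iv (a : BiSeries) : BiSeries :=
  X * PowerSeries.mk fun k => ((k : ℝ) + 1)⁻¹ • coeff k a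

@[ext] theorem ext_bc {a b : BiSeries} (h : ∀ j k, bc j k a = bc j k b) : a = b :=
  PowerSeries.ext fun k => PowerSeries.ext fun j => h j k

theorem bc_add (j k : ℕ) (a b : BiSeries) : bc j k (a + b) = bc j k a + bc j k b := by
  simp [bc]

theorem bc_sub (j k : ℕ) (a b : BiSeries) : bc j k (a - b) = bc j k a - bc j k b := by
  simp [bc]

theorem bc_smul (j k : ℕ) (c : ℝ) (a : BiSeries) : bc j k (c • a) = c * bc j k a := by
  have : coeff k (c • a) = c • coeff k a := rfl
  simp [bc, this]

theorem bc_du (j k : ℕ) (a : BiSeries) : bc j k (du a) = bc (j + 1) k a * (j + 1) := by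
  simp [bc, du, coeff_derivative]

theorem bc_dv (j k : ℕ) (a : BiSeries) : bc j k (dv a) = bc j (k + 1) a * (k + 1) := by
  rw [bc, dv, coeff_derivative]
  have : ((k : ℝ⟦X⟧) + 1) = C ((k : ℝ) + 1) := by simp
  rw [this, coeff_mul_C, bc]

theorem bc_iv_succ (j k : ℕ) (a : BiSeries) :
    bc j (k + 1) (iv a) = ((k : ℝ) + 1)⁻¹ * bc j k a := by
  simp [bc, iv, coeff_succ_X_mul]

theorem bc_iv_zero (j : ℕ) (a : BiSeries) : bc j 0 (iv a) = 0 := by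
  simp [bc, iv]

theorem bc_mul (j k : ℕ) (a b : BiSeries) :
    bc j k (a * b) =
      ∑ q ∈ antidiagonal k, ∑ p ∈ antidiagonal j, bc p.1 q.1 a * bc p.2 q.2 b := by
  simp [bc, coeff_mul]

theorem dv_iv (a : BiSeries) : dv (iv a) = a := by
  ext j k
  rw [bc_dv, bc_iv_succ]
  field_simp

theorem du_iv (a : BiSeries) : du (iv a) = iv (du a) := by
  ext j k
  rw [bc_du]
  cases k with
  | zero => simp [bc_iv_zero]
  | succ k => rw [bc_iv_succ, bc_iv_succ, bc_du]; ring

theorem du_dv (a : BiSeries) : du (dv a) = dv (du a) := by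
  ext j k
  simp only [bc_du, bc_dv]
  ring

theorem du_add (a b : BiSeries) : du (a + b) = du a + du b := by
  ext j k; simp only [bc_du, bc_add]; ring

theorem du_sub (a b : BiSeries) : du (a - b) = du a - du b := by
  ext j k; simp only [bc_du, bc_sub]; ring

theorem du_smul (c : ℝ) (a : BiSeries) : du (c • a) = c • du a := by
  ext j k; simp only [bc_du, bc_smul]; ring

theorem iv_add (a b : BiSeries) : iv (a + b) = iv a + iv b := by
  ext j k
  cases k with
  | zero => simp [bc_iv_zero, bc_add]
  | succ k => simp only [bc_iv_succ, bc_add]; ring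

theorem iv_sub (a b : BiSeries) : iv (a - b) = iv a - iv b := by
  ext j k
  cases k with
  | zero => simp [bc_iv_zero, bc_sub]
  | succ k => simp only [bc_iv_succ, bc_sub]; ring

theorem dv_add (a b : BiSeries) : dv (a + b) = dv a + dv b := map_add _ _ _

theorem dv_sub (a b : BiSeries) : dv (a - b) = dv a - dv b := map_sub _ _ _

theorem dv_smul (c : ℝ) (a : BiSeries) : dv (c • a) = c • dv a := by
  ext j k; simp only [bc_dv, bc_smul]; ring

theorem derivative_mul {A : Type*} [CommRing A] (a b : A⟦X⟧) :
    derivative A (a * b) = derivative A a * b + a * derivative A b := by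
  rw [Derivation.leibniz]
  simp only [smul_eq_mul]
  ring

theorem dv_mul (a b : BiSeries) : dv (a * b) = dv a * b + a * dv b :=
  derivative_mul a b

theorem du_mul (a b : BiSeries) : du (a * b) = du a * b + a * du b := by
  refine PowerSeries.ext fun k => ?_
  simp only [du, map_add, coeff_mul, coeff_mk, map_sum, Derivation.leibniz, smul_eq_mul,
    ← sum_add_distrib]
  exact sum_congr rfl fun q _ => by ring

/-- A series is determined by its derivative in `v` and its restriction to `v = 0`. -/
theorem eq_zero_of_dv {a : BiSeries} (h : dv a = 0) (h0 : ∀ j, bc j 0 a = 0) : a = 0 := by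
  ext j k
  cases k with
  | zero => simpa [bc] using h0 j
  | succ k =>
    have := congrArg (bc j k) h
    rw [bc_dv] at this
    have h1 : ((k : ℝ) + 1) ≠ 0 := by positivity
    have h2 : bc j k 0 = 0 := by simp [bc]
    have h3 : bc j (k + 1) 0 = 0 := by simp [bc]
    rw [h3]
    simpa [h2, h1] using this

/-! ### Divisibility by powers of `v` -/

theorem X_pow_dvd_iff_bc {n : ℕ} {a : BiSeries} :
    X ^ n ∣ a ↔ ∀ k < n, ∀ j, bc j k a = 0 := by
  rw [X_pow_dvd_iff]
  refine forall₂_congr fun k _ => ⟨fun h j => by simp [bc, h], fun h => PowerSeries.ext fun j => ?_⟩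
  simpa [bc] using h j

theorem X_dvd_iv (a : BiSeries) : X ∣ iv a := Dvd.intro _ rfl

theorem X_pow_dvd_iv {n : ℕ} {a : BiSeries} (h : X ^ n ∣ a) : X ^ (n + 1) ∣ iv a := by
  rw [X_pow_dvd_iff_bc] at h ⊢
  intro k hk j
  cases k with
  | zero => exact bc_iv_zero j a
  | succ k => rw [bc_iv_succ, h k (by omega), mul_zero]

theorem X_pow_dvd_du {n : ℕ} {a : BiSeries} (h : X ^ n ∣ a) : X ^ n ∣ du a := by
  rw [X_pow_dvd_iff_bc] at h ⊢
  intro k hk j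
  rw [bc_du, h k hk, zero_mul]

theorem eq_of_forall_X_pow_dvd {a b : BiSeries} (h : ∀ n, X ^ n ∣ a - b) : a = b := by
  ext j k
  have := X_pow_dvd_iff_bc.1 (h (k + 1)) k (by omega) j
  rw [bc_sub] at this
  linarith

/-! ### Weighted norms -/

/-- The weight of the monomial `u ^ j * v ^ k`. -/
def wt (R δ : ℝ≥0) (j k : ℕ) : ℝ≥0 := R ^ (j + k) * δ ^ k / ((j + k).choose k : ℝ≥0)

/-- A weighted `ℓ¹` norm, for which the antiderivative `iv` and the operator `du ∘ iv` have norm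
at most `δ` when `R ≤ 1`. -/
def wnorm (R δ : ℝ≥0) (a : BiSeries) : ℝ≥0∞ :=
  ∑' k, ∑' j, ((wt R δ j k * ‖bc j k a‖₊ : ℝ≥0) : ℝ≥0∞)

theorem choose_mul_choose_le (j j' k k' : ℕ) :
    (j + k).choose k * (j' + k').choose k' ≤ (j + j' + (k + k')).choose (k + k') := by
  have h : j + j' + (k + k') = (j + k) + (j' + k') := by ring
  rw [h, Nat.add_choose_eq (j + k)]
  exact single_le_sum (f := fun p : ℕ × ℕ => (j + k).choose p.1 * (j' + k').choose p.2)
    (fun _ _ => Nat.zero_le _)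
    (HasAntidiagonal.mem_antidiagonal.2 (rfl : (k, k').1 + (k, k').2 = k + k'))

theorem wt_add_le (R δ : ℝ≥0) (j j' k k' : ℕ) :
    wt R δ (j + j') (k + k') ≤ wt R δ j k * wt R δ j' k' := by
  have h : (((j + k).choose k : ℝ≥0) * ((j' + k').choose k' : ℝ≥0))
      ≤ ((j + j' + (k + k')).choose (k + k') : ℝ≥0) := by
    exact_mod_cast choose_mul_choose_le j j' k k'
  have h1 : 0 < ((j + k).choose k : ℝ≥0) := by exact_mod_cast Nat.choose_pos (by omega)
  have h2 : 0 < ((j' + k').choose k' : ℝ≥0) := by exact_mod_cast Nat.choose_pos (by omega)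
  unfold wt
  rw [div_mul_div_comm]
  refine (div_le_div_of_nonneg_left (zero_le) (mul_pos h1 h2) h).trans (le_of_eq ?_)
  congr 1
  ring

theorem wt_mono (R : ℝ≥0) {δ : ℝ≥0} (hδ : δ ≤ 1) (j k : ℕ) : wt R δ j k ≤ wt R 1 j k := by
  unfold wt
  gcongr

theorem wnorm_mono (R : ℝ≥0) {δ : ℝ≥0} (hδ : δ ≤ 1) (a : BiSeries) :
    wnorm R δ a ≤ wnorm R 1 a := by
  unfold wnorm
  refine ENNReal.tsum_le_tsum fun k => ENNReal.tsum_le_tsum fun j => ?_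
  have := wt_mono R hδ j k
  gcongr

theorem wnorm_zero (R δ : ℝ≥0) : wnorm R δ 0 = 0 := by
  simp [wnorm, bc]

theorem wnorm_add_le (R δ : ℝ≥0) (a b : BiSeries) :
    wnorm R δ (a + b) ≤ wnorm R δ a + wnorm R δ b := by
  simp only [wnorm, ← ENNReal.tsum_add]
  refine ENNReal.tsum_le_tsum fun k => ENNReal.tsum_le_tsum fun j => ?_
  rw [← ENNReal.coe_add, ← mul_add, bc_add]
  gcongr
  exact nnnorm_add_le _ _

theorem wnorm_smul (R δ : ℝ≥0) (c : ℝ) (a : BiSeries) :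
    wnorm R δ (c • a) = ‖c‖₊ * wnorm R δ a := by
  simp only [wnorm, ← ENNReal.tsum_mul_left, bc_smul, nnnorm_mul, ENNReal.coe_mul]
  refine tsum_congr fun k => tsum_congr fun j => by ring

theorem wnorm_neg (R δ : ℝ≥0) (a : BiSeries) : wnorm R δ (-a) = wnorm R δ a := by
  have : -a = (-1 : ℝ) • a := by simp
  rw [this, wnorm_smul]; simp

theorem wnorm_sub_le (R δ : ℝ≥0) (a b : BiSeries) :
    wnorm R δ (a - b) ≤ wnorm R δ a + wnorm R δ b := by
  rw [sub_eq_add_neg, ← wnorm_neg R δ b]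
  exact wnorm_add_le R δ a (-b)

theorem tsum_sum_antidiagonal (h : ℕ → ℕ → ℝ≥0∞) :
    ∑' n, ∑ p ∈ antidiagonal n, h p.1 p.2 = ∑' i, ∑' j, h i j := by
  rw [← ENNReal.tsum_prod (f := h),
    ← (HasAntidiagonal.sigmaAntidiagonalEquivProd (A := ℕ)).tsum_eq (fun p : ℕ × ℕ => h p.1 p.2),
    ENNReal.tsum_sigma']
  refine tsum_congr fun n => ?_
  rw [tsum_fintype]
  exact (sum_coe_sort (antidiagonal n) fun p : ℕ × ℕ => h p.1 p.2).symm

theorem wnorm_mul_le (R δ : ℝ≥0) (a b : BiSeries) :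
    wnorm R δ (a * b) ≤ wnorm R δ a * wnorm R δ b := by
  set α : ℕ → ℕ → ℝ≥0∞ := fun j k => ((wt R δ j k * ‖bc j k a‖₊ : ℝ≥0) : ℝ≥0∞) with hα
  set β : ℕ → ℕ → ℝ≥0∞ := fun j k => ((wt R δ j k * ‖bc j k b‖₊ : ℝ≥0) : ℝ≥0∞) with hβ
  have key : ∀ j k, ((wt R δ j k * ‖bc j k (a * b)‖₊ : ℝ≥0) : ℝ≥0∞) ≤
      ∑ q ∈ antidiagonal k, ∑ p ∈ antidiagonal j, α p.1 q.1 * β p.2 q.2 := by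
    intro j k
    simp only [hα, hβ]
    norm_cast
    calc wt R δ j k * ‖bc j k (a * b)‖₊
        ≤ wt R δ j k * ∑ q ∈ antidiagonal k, ∑ p ∈ antidiagonal j,
            ‖bc p.1 q.1 a‖₊ * ‖bc p.2 q.2 b‖₊ := by
          gcongr
          rw [bc_mul]
          refine (nnnorm_sum_le _ _).trans (sum_le_sum fun q _ => ?_)
          refine (nnnorm_sum_le _ _).trans (sum_le_sum fun p _ => ?_)
          rw [nnnorm_mul]
      _ ≤ _ := by
          rw [mul_sum]
          refine sum_le_sum fun q hq => ?_
          rw [mul_sum]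
          refine sum_le_sum fun p hp => ?_
          rw [HasAntidiagonal.mem_antidiagonal] at hp hq
          have := wt_add_le R δ p.1 p.2 q.1 q.2
          rw [hp, hq] at this
          calc _ ≤ (wt R δ p.1 q.1 * wt R δ p.2 q.2) * (‖bc p.1 q.1 a‖₊ * ‖bc p.2 q.2 b‖₊) := by
                gcongr
            _ = _ := by ring
  calc wnorm R δ (a * b)
      ≤ ∑' k, ∑' j, ∑ q ∈ antidiagonal k, ∑ p ∈ antidiagonal j, α p.1 q.1 * β p.2 q.2 :=
        ENNReal.tsum_le_tsum fun k => ENNReal.tsum_le_tsum fun j => key j k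
    _ = ∑' k, ∑ q ∈ antidiagonal k, ∑' j, ∑ p ∈ antidiagonal j, α p.1 q.1 * β p.2 q.2 := by
        refine tsum_congr fun k => ?_
        exact Summable.tsum_finsetSum fun _ _ => ENNReal.summable
    _ = ∑' k, ∑ q ∈ antidiagonal k, (∑' j, α j q.1) * ∑' j, β j q.2 := by
        refine tsum_congr fun k => sum_congr rfl fun q _ => ?_
        rw [tsum_sum_antidiagonal fun i j => α i q.1 * β j q.2]
        simp only [ENNReal.tsum_mul_left, ENNReal.tsum_mul_right]
    _ = _ := by
        rw [tsum_sum_antidiagonal fun k l => (∑' j, α j k) * ∑' j, β j l]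
        simp only [ENNReal.tsum_mul_left, ENNReal.tsum_mul_right]
        rfl

theorem wt_succ_le {R : ℝ≥0} (hR : R ≤ 1) (δ : ℝ≥0) (j k : ℕ) :
    wt R δ j (k + 1) * ((k : ℝ≥0) + 1)⁻¹ ≤ δ * wt R δ j k := by
  have hc : ((j + k).choose k : ℝ≥0) ≤ ((j + (k + 1)).choose (k + 1) : ℝ≥0) * ((k : ℝ≥0) + 1) := by
    have := Nat.add_one_mul_choose_eq (j + k) k
    have h : (j + k).choose k ≤ (j + (k + 1)).choose (k + 1) * (k + 1) := by
      rw [← add_assoc, ← this]; exact Nat.le_mul_of_pos_left _ (by omega)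
    exact_mod_cast h
  have h1 : 0 < ((j + k).choose k : ℝ≥0) := by exact_mod_cast Nat.choose_pos (by omega)
  unfold wt
  rw [← div_eq_mul_inv, div_div, ← mul_div_assoc]
  refine (div_le_div_of_nonneg_left (zero_le) h1 hc).trans (div_le_div_of_nonneg_right ?_ zero_le)
  calc R ^ (j + (k + 1)) * δ ^ (k + 1) = R * (δ * (R ^ (j + k) * δ ^ k)) := by ring
    _ ≤ 1 * (δ * (R ^ (j + k) * δ ^ k)) := by gcongr
    _ = _ := one_mul _

theorem wt_shift (R δ : ℝ≥0) (j k : ℕ) :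
    wt R δ j (k + 1) * ((k : ℝ≥0) + 1)⁻¹ * (j + 1) = δ * wt R δ (j + 1) k := by
  have hc : ((j + (k + 1)).choose (k + 1) : ℝ≥0) * ((k : ℝ≥0) + 1)
      = ((j + 1 + k).choose k : ℝ≥0) * (j + 1) := by
    have h := Nat.choose_succ_right_eq (j + (k + 1)) k
    have h' : j + (k + 1) - k = j + 1 := by omega
    rw [h'] at h
    have h'' : j + 1 + k = j + (k + 1) := by ring
    rw [h'']
    exact_mod_cast h
  have h1 : ((j + (k + 1)).choose (k + 1) : ℝ≥0) ≠ 0 := by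
    exact_mod_cast (Nat.choose_pos (by omega)).ne'
  have h2 : ((j + 1 + k).choose k : ℝ≥0) ≠ 0 := by
    exact_mod_cast (Nat.choose_pos (by omega)).ne'
  have h3 : (k : ℝ≥0) + 1 ≠ 0 := by positivity
  have h4 : j + (k + 1) = j + 1 + k := by ring
  unfold wt
  field_simp
  rw [mul_assoc _ ((j : ℝ≥0) + 1), mul_comm ((j : ℝ≥0) + 1), ← hc, h4]
  ring

theorem wnorm_iv_le {R : ℝ≥0} (hR : R ≤ 1) (δ : ℝ≥0) (a : BiSeries) :
    wnorm R δ (iv a) ≤ δ * wnorm R δ a := by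
  unfold wnorm
  rw [tsum_eq_zero_add' ENNReal.summable]
  simp only [bc_iv_zero, nnnorm_zero, mul_zero, ENNReal.coe_zero, tsum_zero, zero_add,
    ← ENNReal.tsum_mul_left]
  refine ENNReal.tsum_le_tsum fun k => ENNReal.tsum_le_tsum fun j => ?_
  rw [bc_iv_succ, nnnorm_mul, ← ENNReal.coe_mul, ENNReal.coe_le_coe]
  have h : ‖((k : ℝ) + 1)⁻¹‖₊ = ((k : ℝ≥0) + 1)⁻¹ := by
    ext; simp [abs_of_nonneg (by positivity : (0 : ℝ) ≤ k + 1)]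
  rw [h, ← mul_assoc, ← mul_assoc]
  exact mul_le_mul_left (wt_succ_le hR δ j k) _

theorem wnorm_iv_du_le (R δ : ℝ≥0) (a : BiSeries) :
    wnorm R δ (iv (du a)) ≤ δ * wnorm R δ a := by
  unfold wnorm
  rw [tsum_eq_zero_add' ENNReal.summable]
  simp only [bc_iv_zero, nnnorm_zero, mul_zero, ENNReal.coe_zero, tsum_zero, zero_add,
    ← ENNReal.tsum_mul_left]
  refine ENNReal.tsum_le_tsum fun k => ?_
  rw [tsum_eq_zero_add'
    (f := fun j => (δ : ℝ≥0∞) * ((wt R δ j k * ‖bc j k a‖₊ : ℝ≥0) : ℝ≥0∞)) ENNReal.summable]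
  refine le_add_left (ENNReal.tsum_le_tsum fun j => ?_)
  rw [bc_iv_succ, bc_du, nnnorm_mul, nnnorm_mul, ← ENNReal.coe_mul, ENNReal.coe_le_coe]
  have h : ‖((k : ℝ) + 1)⁻¹‖₊ = ((k : ℝ≥0) + 1)⁻¹ := by
    ext; simp [abs_of_nonneg (by positivity : (0 : ℝ) ≤ k + 1)]
  have h' : ‖((j : ℝ) + 1)‖₊ = (j : ℝ≥0) + 1 := by
    ext; simp [abs_of_nonneg (by positivity : (0 : ℝ) ≤ j + 1)]
  have := wt_shift R δ j k
  rw [h, h', ← mul_assoc δ, ← this]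
  apply le_of_eq
  ring

/-! ### Formal fixed points -/

theorem coeff_eq_of_X_pow_dvd {n k : ℕ} {a b : BiSeries} (h : X ^ n ∣ a - b) (hk : k < n) :
    coeff k a = coeff k b := by
  have := X_pow_dvd_iff.1 h k hk
  rwa [map_sub, sub_eq_zero] at this

/-- A map that is contracting for the `v`-adic topology and preserves a ball of the weighted norm
has a fixed point in this ball. -/
theorem exists_fixedPoint {ι : Type*} (R δ : ℝ≥0) (r : ℝ≥0∞)
    (Ψ : (ι → BiSeries) → ι → BiSeries)
    (hc : ∀ n z z', (∀ i, X ^ n ∣ z i - z' i) → ∀ i, X ^ (n + 1) ∣ Ψ z i - Ψ z' i)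
    (hr : ∀ z, (∀ i, wnorm R δ (z i) ≤ r) → ∀ i, wnorm R δ (Ψ z i) ≤ r) :
    ∃ z, Ψ z = z ∧ ∀ i, wnorm R δ (z i) ≤ r := by
  set Z : ℕ → ι → BiSeries := fun n => Ψ^[n] 0 with hZ
  have hZs : ∀ n, Z (n + 1) = Ψ (Z n) := fun n => Function.iterate_succ_apply' Ψ n 0
  have hZn : ∀ n i, wnorm R δ (Z n i) ≤ r := by
    intro n
    induction n with
    | zero => intro i; simp [hZ, wnorm_zero]
    | succ n ih => rw [hZs]; exact hr _ ih
  have h1 : ∀ n i, X ^ n ∣ Z (n + 1) i - Z n i := by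
    intro n
    induction n with
    | zero => intro i; simp
    | succ n ih =>
      intro i
      have := hc n _ _ ih i
      rwa [← hZs, ← hZs] at this
  have h2 : ∀ n m, n ≤ m → ∀ i, X ^ n ∣ Z m i - Z n i := by
    intro n m hm i
    induction m, hm using Nat.le_induction with
    | base => simp
    | succ m hm ih =>
      have := dvd_add ((pow_dvd_pow X hm).trans (h1 m i)) ih
      rwa [sub_add_sub_cancel] at this
  set z : ι → BiSeries := fun i => PowerSeries.mk fun k => coeff k (Z (k + 1) i) with hz
  have h3 : ∀ n i, X ^ n ∣ z i - Z n i := by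
    intro n i
    rw [X_pow_dvd_iff]
    intro k hk
    rw [map_sub, hz, coeff_mk, coeff_eq_of_X_pow_dvd (h2 (k + 1) n hk i) (Nat.lt_succ_self k),
      sub_self]
  refine ⟨z, funext fun i => eq_of_forall_X_pow_dvd fun n => ?_, fun i => ?_⟩
  · have h4 := hc n _ _ (h3 n) i
    rw [← hZs] at h4
    have := dvd_sub h4 (h3 (n + 1) i)
    rw [sub_sub_sub_cancel_right] at this
    exact (pow_dvd_pow X n.le_succ).trans this
  · refine ENNReal.tsum_le_of_sum_range_le fun n => ?_
    calc _ = ∑ k ∈ range n, ∑' j, ((wt R δ j k * ‖bc j k (Z n i)‖₊ : ℝ≥0) : ℝ≥0∞) := by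
          refine sum_congr rfl fun k hk => tsum_congr fun j => ?_
          rw [bc, bc, coeff_eq_of_X_pow_dvd (h3 n i) (mem_range.1 hk)]
      _ ≤ wnorm R δ (Z n i) := ENNReal.sum_le_tsum _
      _ ≤ r := hZn n i

/-- The Minkowski product of triples of formal series. -/
def fm (a b : Fin 3 → BiSeries) : BiSeries := a 0 * b 0 + a 1 * b 1 - a 2 * b 2

theorem wnorm_fm_le {R δ : ℝ≥0} {a b : Fin 3 → BiSeries} {A B : ℝ≥0∞}
    (ha : ∀ i, wnorm R δ (a i) ≤ A) (hb : ∀ i, wnorm R δ (b i) ≤ B) :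
    wnorm R δ (fm a b) ≤ 3 * (A * B) := by
  have h : ∀ i, wnorm R δ (a i * b i) ≤ A * B := fun i =>
    (wnorm_mul_le R δ _ _).trans (mul_le_mul' (ha i) (hb i))
  calc wnorm R δ (fm a b)
      ≤ wnorm R δ (a 0 * b 0) + wnorm R δ (a 1 * b 1) + wnorm R δ (a 2 * b 2) :=
        (wnorm_sub_le R δ _ _).trans (add_le_add_left (wnorm_add_le R δ _ _) _)
    _ ≤ A * B + A * B + A * B := add_le_add (add_le_add (h 0) (h 1)) (h 2)
    _ = 3 * (A * B) := by ring

theorem X_pow_dvd_fm_sub {n m : ℕ} {a a' b b' : Fin 3 → BiSeries}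
    (ha : ∀ i, X ^ n ∣ a i - a' i) (hb : ∀ i, X ^ (n + m) ∣ b i - b' i)
    (hb0 : ∀ i, X ^ m ∣ b i) : X ^ (n + m) ∣ fm a b - fm a' b' := by
  have h : ∀ i, X ^ (n + m) ∣ a i * b i - a' i * b' i := fun i => by
    have h1 : X ^ (n + m) ∣ (a i - a' i) * b i := by
      rw [pow_add]; exact mul_dvd_mul (ha i) (hb0 i)
    have h2 : X ^ (n + m) ∣ a' i * (b i - b' i) := Dvd.dvd.mul_left (hb i) _
    have := dvd_add h1 h2
    convert! this using 1
    ring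
  have := dvd_sub (dvd_add (h 0) (h 1)) (h 2)
  convert! this using 1
  simp only [fm]
  ring

theorem exists_formal_solution {R : ℝ≥0} (hR : R ≤ 1) (D e p q : Fin 3 → BiSeries)
    (g₁ g₂ g₃ : BiSeries)
    (hD : ∀ i, wnorm R 1 (D i) < ⊤) (he : ∀ i, wnorm R 1 (e i) < ⊤)
    (hp : ∀ i, wnorm R 1 (p i) < ⊤) (hq : ∀ i, wnorm R 1 (q i) < ⊤)
    (h₁ : wnorm R 1 g₁ < ⊤) (h₂ : wnorm R 1 g₂ < ⊤) (h₃ : wnorm R 1 g₃ < ⊤) :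
    ∃ δ : ℝ≥0, 0 < δ ∧ δ ≤ 1 ∧ ∃ z y : Fin 3 → BiSeries,
      (∀ i, wnorm R δ (z i) < ⊤) ∧ (∀ i, y i = D i + iv (du (z i))) ∧
      ∀ i, z i = (g₁ - fm z fun i => iv (y i)) * e i
        + (fm y y + g₃ - fm z fun i => iv (du (y i))) * p i
        + (g₂ - fm z fun i => iv (z i)) * q i := by
  obtain ⟨K, hKD, hKe, hKp, hKq, hK1, hK2, hK3⟩ : ∃ K : ℝ≥0, (∀ i, wnorm R 1 (D i) ≤ K) ∧
      (∀ i, wnorm R 1 (e i) ≤ K) ∧ (∀ i, wnorm R 1 (p i) ≤ K) ∧ (∀ i, wnorm R 1 (q i) ≤ K) ∧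
      wnorm R 1 g₁ ≤ K ∧ wnorm R 1 g₂ ≤ K ∧ wnorm R 1 g₃ ≤ K := by
    set T : ℝ≥0∞ := ∑ i, wnorm R 1 (D i) + ∑ i, wnorm R 1 (e i) + ∑ i, wnorm R 1 (p i)
      + ∑ i, wnorm R 1 (q i) + wnorm R 1 g₁ + wnorm R 1 g₂ + wnorm R 1 g₃ with hT
    have hTt : T ≠ ⊤ := by
      simp only [hT, Fin.sum_univ_three]
      simp only [ne_eq, ENNReal.add_eq_top, not_or]
      exact ⟨⟨⟨⟨⟨⟨⟨⟨(hD 0).ne, (hD 1).ne⟩, (hD 2).ne⟩, ⟨(he 0).ne, (he 1).ne⟩, (he 2).ne⟩,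
        ⟨(hp 0).ne, (hp 1).ne⟩, (hp 2).ne⟩, ⟨(hq 0).ne, (hq 1).ne⟩, (hq 2).ne⟩, h₁.ne⟩, h₂.ne⟩,
        h₃.ne⟩
    have hs : ∀ (a : Fin 3 → BiSeries) i, wnorm R 1 (a i) ≤ ∑ i, wnorm R 1 (a i) := fun a i =>
      single_le_sum (f := fun i => wnorm R 1 (a i)) (fun _ _ => zero_le) (mem_univ i)
    refine ⟨T.toNNReal, ?_⟩
    rw [ENNReal.coe_toNNReal hTt, hT]
    refine ⟨fun i => (hs D i).trans ?_, fun i => (hs e i).trans ?_, fun i => (hs p i).trans ?_,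
      fun i => (hs q i).trans ?_, ?_, ?_, ?_⟩
    · simp only [add_assoc]; exact le_self_add
    · rw [add_assoc, add_assoc, add_assoc, add_assoc]
      exact le_add_right le_add_self
    · rw [add_assoc, add_assoc, add_assoc]
      exact le_add_right le_add_self
    · rw [add_assoc, add_assoc]
      exact le_add_right le_add_self
    · rw [add_assoc]
      exact le_add_right le_add_self
    · exact le_add_right le_add_self
    · exact le_add_self
  set L : ℝ≥0 := 3 * (K + 1) ^ 2 + K + 3 * (K + 1) with hL
  set r : ℝ≥0 := 3 * (L * K) + 1 with hr
  have hr1 : 1 ≤ r := by rw [hr]; exact le_add_self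
  set δ : ℝ≥0 := (r ^ 2)⁻¹ with hδ
  have hr0 : 0 < r := lt_of_lt_of_le one_pos hr1
  have hδ0 : 0 < δ := by positivity
  have hδ1 : δ ≤ 1 := inv_le_one_of_one_le₀ (one_le_pow₀ hr1)
  have hδr2 : r * (δ * r) = 1 := by rw [hδ]; field_simp
  have hδr : δ * r ≤ 1 := by
    rw [← hδr2]; exact le_mul_of_one_le_left zero_le hr1
  set Y : (Fin 3 → BiSeries) → Fin 3 → BiSeries := fun z i => D i + iv (du (z i)) with hY
  set Ψ : (Fin 3 → BiSeries) → Fin 3 → BiSeries := fun z i =>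
    (g₁ - fm z fun i => iv (Y z i)) * e i
        + (fm (Y z) (Y z) + g₃ - fm z fun i => iv (du (Y z i))) * p i
        + (g₂ - fm z fun i => iv (z i)) * q i with hΨ
  suffices h : (∀ n z z', (∀ i, X ^ n ∣ z i - z' i) → ∀ i, X ^ (n + 1) ∣ Ψ z i - Ψ z' i) ∧
      ∀ z, (∀ i, wnorm R δ (z i) ≤ r) → ∀ i, wnorm R δ (Ψ z i) ≤ r by
    obtain ⟨z, hz, hzr⟩ := exists_fixedPoint R δ r Ψ h.1 h.2
    exact ⟨δ, hδ0, hδ1, z, Y z, fun i => (hzr i).trans_lt ENNReal.coe_lt_top, fun i => rfl,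
      fun i => (congrFun hz i).symm⟩
  constructor
  · intro n z z' h i
    have hy : ∀ i, X ^ (n + 1) ∣ Y z i - Y z' i := fun i => by
      simp only [hY, add_sub_add_left_eq_sub, ← iv_sub, ← du_sub]
      exact X_pow_dvd_iv (X_pow_dvd_du (h i))
    have hy' : ∀ i, X ^ n ∣ Y z i - Y z' i := fun i => (pow_dvd_pow X n.le_succ).trans (hy i)
    have h1 : X ^ (n + 1) ∣ (fm z fun i => iv (Y z i)) - fm z' fun i => iv (Y z' i) :=
      X_pow_dvd_fm_sub h (fun i => by rw [← iv_sub]; exact X_pow_dvd_iv (hy' i))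
        fun i => by rw [pow_one]; exact X_dvd_iv _
    have h2 : X ^ (n + 1) ∣ (fm z fun i => iv (z i)) - fm z' fun i => iv (z' i) :=
      X_pow_dvd_fm_sub h (fun i => by rw [← iv_sub]; exact X_pow_dvd_iv (h i))
        fun i => by rw [pow_one]; exact X_dvd_iv _
    have h3 : X ^ (n + 1) ∣ (fm z fun i => iv (du (Y z i))) - fm z' fun i => iv (du (Y z' i)) :=
      X_pow_dvd_fm_sub h
        (fun i => by rw [← iv_sub, ← du_sub]; exact X_pow_dvd_iv (X_pow_dvd_du (hy' i)))
        fun i => by rw [pow_one]; exact X_dvd_iv _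
    have h4 : X ^ (n + 1 + 0) ∣ fm (Y z) (Y z) - fm (Y z') (Y z') :=
      X_pow_dvd_fm_sub hy hy fun i => by simp
    have := dvd_add (dvd_add (Dvd.dvd.mul_right (dvd_neg.2 h1) (e i))
      (Dvd.dvd.mul_right (dvd_sub h4 h3) (p i))) (Dvd.dvd.mul_right (dvd_neg.2 h2) (q i))
    convert! this using 1
    simp only [hΨ]
    ring
  · intro z hzr i
    have mono : ∀ {a : BiSeries}, wnorm R 1 a ≤ K → wnorm R δ a ≤ K := fun h =>
      (wnorm_mono R hδ1 _).trans h
    have hYn : ∀ i, wnorm R δ (Y z i) ≤ (K + 1 : ℝ≥0) := fun i => by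
      refine (wnorm_add_le R δ _ _).trans ?_
      rw [ENNReal.coe_add]
      refine add_le_add (mono (hKD i)) ((wnorm_iv_du_le R δ _).trans ?_)
      exact (mul_le_mul' le_rfl (hzr i)).trans (by exact_mod_cast hδr)
    have hcomp : ∀ {A B : ℝ≥0}, r * (δ * A) ≤ B →
        (3 : ℝ≥0∞) * ((r : ℝ≥0∞) * ((δ : ℝ≥0∞) * (A : ℝ≥0∞))) ≤ (3 * B : ℝ≥0) := fun h => by
      have : (3 : ℝ≥0∞) = ((3 : ℝ≥0) : ℝ≥0∞) := rfl
      rw [this]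
      exact_mod_cast mul_le_mul' le_rfl h
    have hrδ : r * (δ * (K + 1)) ≤ K + 1 := by
      rw [← mul_assoc, mul_comm r]; exact mul_le_of_le_one_left zero_le hδr
    have hn1 : wnorm R δ (fm z fun i => iv (Y z i)) ≤ (3 * (K + 1) : ℝ≥0) :=
      (wnorm_fm_le hzr fun i => (wnorm_iv_le hR δ _).trans (mul_le_mul' le_rfl (hYn i))).trans
        (hcomp hrδ)
    have hn2 : wnorm R δ (fm z fun i => iv (z i)) ≤ (3 * 1 : ℝ≥0) :=
      (wnorm_fm_le hzr fun i => (wnorm_iv_le hR δ _).trans (mul_le_mul' le_rfl (hzr i))).trans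
        (hcomp hδr2.le)
    have hn3 : wnorm R δ (fm z fun i => iv (du (Y z i))) ≤ (3 * (K + 1) : ℝ≥0) :=
      (wnorm_fm_le hzr fun i => (wnorm_iv_du_le R δ _).trans (mul_le_mul' le_rfl (hYn i))).trans
        (hcomp hrδ)
    have hn4 : wnorm R δ (fm (Y z) (Y z)) ≤ (3 * (K + 1) ^ 2 : ℝ≥0) := by
      refine (wnorm_fm_le hYn hYn).trans (le_of_eq ?_)
      rw [sq]; rfl
    have hb1 : wnorm R δ (g₁ - fm z fun i => iv (Y z i)) ≤ L := by
      refine ((wnorm_sub_le R δ _ _).trans (add_le_add (mono hK1) hn1)).trans ?_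
      rw [hL, add_assoc]
      exact_mod_cast le_add_self
    have hb2 : wnorm R δ (g₂ - fm z fun i => iv (z i)) ≤ L := by
      refine ((wnorm_sub_le R δ _ _).trans (add_le_add (mono hK2) hn2)).trans ?_
      rw [hL, add_assoc]
      have : K + 3 * 1 ≤ K + 3 * (K + 1) := by gcongr; exact le_add_self
      exact_mod_cast this.trans le_add_self
    have hb3 : wnorm R δ (fm (Y z) (Y z) + g₃ - fm z fun i => iv (du (Y z i))) ≤ L := by
      refine ((wnorm_sub_le R δ _ _).trans (add_le_add ((wnorm_add_le R δ _ _).trans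
        (add_le_add hn4 (mono hK3))) hn3)).trans ?_
      rw [hL]
      exact_mod_cast le_rfl
    have hm : ∀ {a b : BiSeries}, wnorm R δ a ≤ L → wnorm R 1 b ≤ K →
        wnorm R δ (a * b) ≤ (L * K : ℝ≥0) := fun ha hb =>
      (wnorm_mul_le R δ _ _).trans ((mul_le_mul' ha (mono hb)).trans (by exact_mod_cast le_rfl))
    refine ((wnorm_add_le R δ _ _).trans (add_le_add ((wnorm_add_le R δ _ _).trans
      (add_le_add (hm hb1 (hKe i)) (hm hb3 (hKp i)))) (hm hb2 (hKq i)))).trans ?_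
    rw [hr]
    have : L * K + L * K + L * K ≤ 3 * (L * K) + 1 := by
      refine le_trans (le_of_eq ?_) le_self_add
      ring
    exact_mod_cast this

theorem constantCoeff_iv (a : BiSeries) : constantCoeff (iv a) = 0 := by
  simp [iv]

theorem eq_of_dv_eq {a b : BiSeries} (h : dv a = dv b) (h0 : constantCoeff a = constantCoeff b) :
    a = b := by
  refine sub_eq_zero.1 (eq_zero_of_dv (by rw [dv_sub, h, sub_self]) fun j => ?_)
  simp [bc, h0]

theorem dv_fm (a b : Fin 3 → BiSeries) :
    dv (fm a b) = fm (fun i => dv (a i)) b + fm a fun i => dv (b i) := by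
  simp only [fm, dv_add, dv_sub, dv_mul]
  ring

theorem du_fm (a b : Fin 3 → BiSeries) :
    du (fm a b) = fm (fun i => du (a i)) b + fm a fun i => du (b i) := by
  simp only [fm, du_add, du_sub, du_mul]
  ring

theorem fm_comm (a b : Fin 3 → BiSeries) : fm a b = fm b a := by
  simp only [fm]; ring

theorem fm_add_right (a b c : Fin 3 → BiSeries) :
    fm a (fun i => b i + c i) = fm a b + fm a c := by
  simp only [fm]; ring

/-- Formal version of the argument that solutions of the second order equation with isometric
initial data are isometric. -/
theorem formal_isometric {E G : BiSeries} {F z : Fin 3 → BiSeries}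
    (hFvv : ∀ i, dv (dv (F i)) = z i)
    (h₁ : 2 * fm z (fun i => du (F i)) = - du G)
    (h₂ : 2 * fm z (fun i => dv (F i)) = dv G)
    (h₃ : 2 * fm z (fun i => du (du (F i))) =
      2 * fm (fun i => du (dv (F i))) (fun i => du (dv (F i))) - dv (dv E) - du (du G))
    (i₁ : constantCoeff (fm (fun i => du (F i)) fun i => du (F i)) = constantCoeff E)
    (i₂ : constantCoeff (2 * fm (fun i => du (F i)) fun i => du (dv (F i))) =
      constantCoeff (dv E))
    (i₃ : constantCoeff (fm (fun i => du (F i)) fun i => dv (F i)) = 0)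
    (i₄ : constantCoeff (fm (fun i => dv (F i)) fun i => dv (F i)) = constantCoeff G) :
    fm (fun i => du (F i)) (fun i => du (F i)) = E ∧
    fm (fun i => du (F i)) (fun i => dv (F i)) = 0 ∧
    fm (fun i => dv (F i)) (fun i => dv (F i)) = G := by
  have two : ∀ a b : BiSeries, 2 * a = 2 * b → a = b := fun a b h => by
    refine ext_bc fun j k => ?_
    have := congrArg (bc j k) h
    simp only [two_mul, bc_add] at this
    linarith
  have du_two : ∀ a : BiSeries, du (2 * a) = 2 * du a := fun a => by
    rw [two_mul, du_add, two_mul]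
  have dv_two : ∀ a : BiSeries, dv (2 * a) = 2 * dv a := fun a => by
    rw [two_mul, dv_add, two_mul]
  have hG : fm (fun i => dv (F i)) (fun i => dv (F i)) = G := by
    refine eq_of_dv_eq ?_ i₄
    rw [dv_fm, ← h₂]
    simp only [hFvv]
    rw [fm_comm (fun i => dv (F i))]
    ring
  have hzu : fm z (fun i => du (F i)) + fm (fun i => dv (F i)) (fun i => du (dv (F i))) = 0 := by
    apply two
    have := congrArg du hG
    rw [du_fm, fm_comm] at this
    linear_combination h₁ + this
  refine ⟨?_, ?_, hG⟩
  · refine eq_of_dv_eq (eq_of_dv_eq ?_ ?_) i₁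
    · have h := congrArg du h₁
      rw [du_two, du_fm, ← hG] at h
      have hG2 := congrArg du (congrArg du hG)
      have e1 : dv (fm (fun i => du (F i)) fun i => du (F i)) =
          2 * fm (fun i => du (F i)) (fun i => du (dv (F i))) := by
        rw [dv_fm, fm_comm, two_mul]
        simp only [du_dv]
      rw [e1, dv_two, dv_fm]
      simp only [← du_dv, hFvv]
      rw [fm_comm (fun i => du (z i))] at h
      have hneg : du (-du (fm (fun i => dv (F i)) fun i => dv (F i))) = - du (du G) := by
        rw [hG]
        have : - du G = (-1 : ℝ) • du G := by simp
        rw [this, du_smul]; simp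
      rw [hneg] at h
      linear_combination h - h₃
    · rw [← i₂, dv_fm, fm_comm, ← two_mul]
      simp only [du_dv]
  · refine eq_of_dv_eq ?_ (by rw [i₃, map_zero])
    have h0 : dv (0 : BiSeries) = 0 := map_zero _
    rw [dv_fm, h0]
    simp only [hFvv, ← du_dv]
    rw [fm_comm, add_comm, fm_comm _ z]
    exact hzu

/-- Formal isometric realizations whose initial curve is a circle of curvature `κ`. -/
theorem exists_formal_isometric {R : ℝ≥0} (hR : R ≤ 1) {E G s c l m k k' : BiSeries}
    (hs : du s = k * c) (hc : du c = -(k * s)) (hk' : du k' = 0)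
    (hsv : dv s = 0) (hcv : dv c = 0) (hkv' : dv k' = 0)
    (hlv : dv l = 0) (hsc : c * c + s * s = 1) (hlm : l * m = 1) (hkk : k * k' = 1)
    (hG : constantCoeff G = 0) (hE : constantCoeff E = 1)
    (hEv : constantCoeff (dv E) = constantCoeff (2 * (k * l)))
    (ns : wnorm R 1 s < ⊤) (nc : wnorm R 1 c < ⊤) (nl : wnorm R 1 l < ⊤)
    (nl' : wnorm R 1 (du l) < ⊤) (nm : wnorm R 1 m < ⊤) (nk : wnorm R 1 k < ⊤)
    (nk' : wnorm R 1 k' < ⊤) (nGu : wnorm R 1 (du G) < ⊤) (nGv : wnorm R 1 (dv G) < ⊤)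
    (nGuu : wnorm R 1 (du (du G)) < ⊤) (nEvv : wnorm R 1 (dv (dv E)) < ⊤) :
    ∃ δ : ℝ≥0, 0 < δ ∧ δ ≤ 1 ∧ ∃ F : Fin 3 → BiSeries, (∀ i, wnorm R δ (F i) < ⊤) ∧
      fm (fun i => du (F i)) (fun i => du (F i)) = E ∧
      fm (fun i => du (F i)) (fun i => dv (F i)) = 0 ∧
      fm (fun i => dv (F i)) (fun i => dv (F i)) = G ∧
      (∀ i, constantCoeff (du (F i)) = constantCoeff (![-s, c, 0] i)) ∧
      (∀ i, constantCoeff (dv (F i)) = constantCoeff (![l * c, l * s, l] i)) ∧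
      (∀ i, constantCoeff (du (du (F i))) = constantCoeff (![-(k * c), -(k * s), 0] i)) := by
  have tmul : ∀ {a b : BiSeries}, wnorm R 1 a < ⊤ → wnorm R 1 b < ⊤ → wnorm R 1 (a * b) < ⊤ :=
    fun ha hb => (wnorm_mul_le R 1 _ _).trans_lt (ENNReal.mul_lt_top ha hb)
  have tadd : ∀ {δ : ℝ≥0} {a b : BiSeries}, wnorm R δ a < ⊤ → wnorm R δ b < ⊤ →
      wnorm R δ (a + b) < ⊤ :=
    fun ha hb => (wnorm_add_le R _ _ _).trans_lt (ENNReal.add_lt_top.2 ⟨ha, hb⟩)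
  have tneg : ∀ {a : BiSeries}, wnorm R 1 a < ⊤ → wnorm R 1 (-a) < ⊤ :=
    fun ha => by rwa [wnorm_neg]
  have tsm : ∀ (t : ℝ) {a : BiSeries}, wnorm R 1 a < ⊤ → wnorm R 1 (t • a) < ⊤ :=
    fun t a ha => by rw [wnorm_smul]; exact ENNReal.mul_lt_top ENNReal.coe_lt_top ha
  have t0 : wnorm R 1 0 < ⊤ := by rw [wnorm_zero]; exact ENNReal.zero_lt_top
  have tiv : ∀ {δ : ℝ≥0} {a : BiSeries}, wnorm R δ a < ⊤ → wnorm R δ (iv a) < ⊤ :=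
    fun ha => (wnorm_iv_le hR _ _).trans_lt (ENNReal.mul_lt_top ENNReal.coe_lt_top ha)
  have half : ∀ a : BiSeries, 2 * ((1 / 2 : ℝ) • a) = a := fun a => by
    rw [two_mul, ← add_smul]; norm_num
  have du0 : du (0 : BiSeries) = 0 := ext_bc fun j n => by rw [bc_du]; simp [bc]
  have dv0 : dv (0 : BiSeries) = 0 := map_zero _
  have du_neg : ∀ a : BiSeries, du (-a) = - du a := fun a => by
    have := du_sub 0 a
    simpa [du0] using this
  set ξ : Fin 3 → BiSeries := ![l * c, l * s, l] with hξ
  obtain ⟨δ, hδ0, hδ1, z, y, hzt, hy, hz⟩ := exists_formal_solution hR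
    (fun i => du (ξ i)) ![-s, c, 0] ![-(k' * c), -(k' * s), -k'] ![0, 0, -m]
    (-((1 / 2 : ℝ) • du G)) ((1 / 2 : ℝ) • dv G) (-((1 / 2 : ℝ) • (dv (dv E) + du (du G))))
    (by
      intro i; fin_cases i
      · simp only [hξ, Fin.zero_eta, Matrix.cons_val_zero, du_mul, hc]
        exact tadd (tmul nl' nc) (tmul nl (tneg (tmul nk ns)))
      · simp only [hξ, Fin.mk_one, Matrix.cons_val_one, Matrix.cons_val_zero, du_mul, hs]
        exact tadd (tmul nl' ns) (tmul nl (tmul nk nc))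
      · exact nl')
    (by intro i; fin_cases i; exacts [tneg ns, nc, t0])
    (by intro i; fin_cases i; exacts [tneg (tmul nk' nc), tneg (tmul nk' ns), tneg nk'])
    (by intro i; fin_cases i; exacts [t0, t0, tneg nm])
    (tneg (tsm _ nGu)) (tsm _ nGv) (tneg (tsm _ (tadd nEvv nGuu)))
  set γ : Fin 3 → BiSeries := ![k' * c, k' * s, 0] with hγ
  set F : Fin 3 → BiSeries := fun i => γ i + iv (ξ i) + iv (iv (z i)) with hF
  have hγu : ∀ i, du (γ i) = ![-s, c, 0] i := by
    intro i; fin_cases i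
    · simp only [hγ, Fin.zero_eta, Matrix.cons_val_zero, du_mul, hc, hk']
      linear_combination (-s) * hkk
    · simp only [hγ, Fin.mk_one, Matrix.cons_val_one, Matrix.cons_val_zero, du_mul, hs, hk']
      linear_combination c * hkk
    · simpa [hγ] using du0
  have hγuu : ∀ i, du (![-s, c, 0] i) = ![-(k * c), -(k * s), 0] i := by
    intro i; fin_cases i
    · simp [du_neg, hs]
    · simp [hc]
    · simpa using du0
  have hγv : ∀ i, dv (γ i) = 0 := by
    intro i; fin_cases i
    · simp [hγ, dv_mul, hcv, hkv']
    · simp [hγ, dv_mul, hsv, hkv']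
    · simpa [hγ] using dv0
  have hξv : ∀ i, dv (ξ i) = 0 := by
    intro i; fin_cases i
    · simp [hξ, dv_mul, hcv, hlv]
    · simp [hξ, dv_mul, hsv, hlv]
    · simpa [hξ] using hlv
  have hFv : ∀ i, dv (F i) = ξ i + iv (z i) := fun i => by
    simp only [hF, dv_add, dv_iv, hγv, zero_add]
  have hFvv : ∀ i, dv (dv (F i)) = z i := fun i => by
    rw [hFv, dv_add, dv_iv, hξv, zero_add]
  have hFuv : ∀ i, du (dv (F i)) = y i := fun i => by
    rw [hFv, du_add, du_iv, hy]
  have hFu : ∀ i, du (F i) = ![-s, c, 0] i + iv (y i) := fun i => by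
    simp only [hF, du_add, du_iv, hγu, hy, iv_add, add_assoc]
  have hFuu : ∀ i, du (du (F i)) = ![-(k * c), -(k * s), 0] i + iv (du (y i)) := fun i => by
    rw [hFu, du_add, hγuu, du_iv]
  have z0 := hz 0
  have z1 := hz 1
  have z2 := hz 2
  simp only [Matrix.cons_val_zero, Matrix.cons_val_one, Matrix.cons_val,
    mul_zero, add_zero, zero_add] at z0 z1 z2
  set b₁ := -((1 / 2 : ℝ) • du G) - fm z fun i => iv (y i) with hb₁
  set b₂ := (1 / 2 : ℝ) • dv G - fm z fun i => iv (z i) with hb₂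
  set b₃ := fm y y + -((1 / 2 : ℝ) • (dv (dv E) + du (du G))) - fm z fun i => iv (du (y i))
    with hb₃
  have q₁ : fm z ![-s, c, 0] = b₁ := by
    simp only [fm, Matrix.cons_val_zero, Matrix.cons_val_one, Matrix.cons_val]
    rw [z0, z1]
    linear_combination b₁ * hsc
  have q₂ : fm z ξ = b₂ := by
    simp only [fm, hξ, Matrix.cons_val_zero, Matrix.cons_val_one,
      Matrix.cons_val]
    rw [z0, z1, z2]
    linear_combination (-(b₃ * k' * l)) * hsc + b₂ * hlm
  have q₃ : fm z ![-(k * c), -(k * s), 0] = b₃ := by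
    simp only [fm, Matrix.cons_val_zero, Matrix.cons_val_one, Matrix.cons_val]
    rw [z0, z1]
    linear_combination (b₃ * k * k') * hsc + b₃ * hkk
  have hg1 := half (du G)
  have hg2 := half (dv G)
  have hg3 := half (dv (dv E) + du (du G))
  have cFu : ∀ i, constantCoeff (du (F i)) = constantCoeff (![-s, c, 0] i) := fun i => by
    rw [hFu, map_add, constantCoeff_iv, add_zero]
  have cFv : ∀ i, constantCoeff (dv (F i)) = constantCoeff (ξ i) := fun i => by
    rw [hFv, map_add, constantCoeff_iv, add_zero]
  have cFuu : ∀ i, constantCoeff (du (du (F i))) =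
      constantCoeff (![-(k * c), -(k * s), 0] i) := fun i => by
    rw [hFuu, map_add, constantCoeff_iv, add_zero]
  have cFuv : ∀ i, constantCoeff (du (dv (F i))) = constantCoeff (du (ξ i)) := fun i => by
    rw [hFuv, hy, map_add, constantCoeff_iv, add_zero]
  have cfm : ∀ a b : Fin 3 → BiSeries, constantCoeff (fm a b) =
      constantCoeff (a 0) * constantCoeff (b 0) + constantCoeff (a 1) * constantCoeff (b 1)
        - constantCoeff (a 2) * constantCoeff (b 2) := fun a b => by
    simp only [fm, map_add, map_sub, map_mul]
  have csc : constantCoeff c * constantCoeff c + constantCoeff s * constantCoeff s = 1 := by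
    rw [← map_mul, ← map_mul, ← map_add, hsc, map_one]
  have hiso := formal_isometric (E := E) (G := G) hFvv ?_ ?_ ?_ ?_ ?_ ?_ ?_
  · refine ⟨δ, hδ0, hδ1, F, fun i => tadd (tadd ?_ (tiv ?_)) (tiv (tiv (hzt i))), hiso.1, hiso.2.1,
      hiso.2.2, cFu, cFv, cFuu⟩
    · refine (wnorm_mono R hδ1 _).trans_lt ?_
      fin_cases i
      exacts [tmul nk' nc, tmul nk' ns, t0]
    · refine (wnorm_mono R hδ1 _).trans_lt ?_
      fin_cases i
      exacts [tmul nl nc, tmul nl ns, nl]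
  · simp only [hFu]
    rw [fm_add_right, q₁, hb₁]
    linear_combination -hg1
  · simp only [hFv]
    rw [fm_add_right, q₂, hb₂]
    linear_combination hg2
  · simp only [hFuu, hFuv]
    rw [fm_add_right, q₃, hb₃]
    linear_combination -hg3
  · simp only [cfm, cFu]
    simp only [Matrix.cons_val_zero, Matrix.cons_val_one, Matrix.cons_val,
      map_neg, map_zero, hE]
    linear_combination csc
  · rw [hEv, map_mul, map_mul, cfm]
    simp only [cFu, cFuv]
    simp only [hξ, Matrix.cons_val_zero, Matrix.cons_val_one,
      Matrix.cons_val, map_neg, map_zero, du_mul, hs, hc, map_add, map_mul]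
    linear_combination (constantCoeff 2 * constantCoeff l * constantCoeff k) * csc
  · simp only [cfm, cFu, cFv]
    simp only [hξ, Matrix.cons_val_zero, Matrix.cons_val_one,
      Matrix.cons_val, map_neg, map_zero, map_mul]
    ring
  · simp only [cfm, cFv]
    simp only [hξ, Matrix.cons_val_zero, Matrix.cons_val_one,
      Matrix.cons_val, map_mul, hG]
    linear_combination (constantCoeff l * constantCoeff l) * csc

end BiSeries

section PartialDerivatives

variable {V : Type*} [NormedAddCommGroup V] [NormedSpace ℝ V]

theorem analyticAt_pu [CompleteSpace V] {f : ℝ × ℝ → V} {q : ℝ × ℝ} (h : AnalyticAt ℝ f q) :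
    AnalyticAt ℝ (pu f) q :=
  ((ContinuousLinearMap.apply ℝ V ((1 : ℝ), (0 : ℝ))).analyticAt _).comp h.fderiv

theorem analyticAt_pv [CompleteSpace V] {f : ℝ × ℝ → V} {q : ℝ × ℝ} (h : AnalyticAt ℝ f q) :
    AnalyticAt ℝ (pv f) q :=
  ((ContinuousLinearMap.apply ℝ V ((0 : ℝ), (1 : ℝ))).analyticAt _).comp h.fderiv

theorem pu_congr {f g : ℝ × ℝ → V} {q : ℝ × ℝ} (h : f =ᶠ[𝓝 q] g) : pu f =ᶠ[𝓝 q] pu g :=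
  h.fderiv.fun_comp fun L : ℝ × ℝ →L[ℝ] V => L (1, 0)

theorem pv_congr {f g : ℝ × ℝ → V} {q : ℝ × ℝ} (h : f =ᶠ[𝓝 q] g) : pv f =ᶠ[𝓝 q] pv g :=
  h.fderiv.fun_comp fun L : ℝ × ℝ →L[ℝ] V => L (0, 1)

theorem eventually_differentiableAt {f : ℝ × ℝ → V} {q : ℝ × ℝ} [CompleteSpace V]
    (h : AnalyticAt ℝ f q) : ∀ᶠ x in 𝓝 q, DifferentiableAt ℝ f x :=
  h.eventually_analyticAt.mono fun _ hx => hx.differentiableAt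

theorem pu_add {f g : ℝ × ℝ → V} {q : ℝ × ℝ} [CompleteSpace V]
    (hf : AnalyticAt ℝ f q) (hg : AnalyticAt ℝ g q) : pu (f + g) =ᶠ[𝓝 q] pu f + pu g := by
  filter_upwards [eventually_differentiableAt hf, eventually_differentiableAt hg] with x h1 h2
  simp [pu, fderiv_add h1 h2]

theorem pv_add {f g : ℝ × ℝ → V} {q : ℝ × ℝ} [CompleteSpace V]
    (hf : AnalyticAt ℝ f q) (hg : AnalyticAt ℝ g q) : pv (f + g) =ᶠ[𝓝 q] pv f + pv g := by
  filter_upwards [eventually_differentiableAt hf, eventually_differentiableAt hg] with x h1 h2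
  simp [pv, fderiv_add h1 h2]

theorem pu_smul (c : ℝ) (f : ℝ × ℝ → V) : pu (c • f) = c • pu f := by
  funext x
  simp [pu, fderiv_const_smul_field]

theorem pv_smul (c : ℝ) (f : ℝ × ℝ → V) : pv (c • f) = c • pv f := by
  funext x
  simp [pv, fderiv_const_smul_field]

theorem pu_mul {f g : ℝ × ℝ → ℝ} {q : ℝ × ℝ}
    (hf : AnalyticAt ℝ f q) (hg : AnalyticAt ℝ g q) :
    pu (f * g) =ᶠ[𝓝 q] pu f * g + f * pu g := by
  filter_upwards [eventually_differentiableAt hf, eventually_differentiableAt hg] with x h1 h2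
  simp [pu, fderiv_mul h1 h2]
  ring

theorem pv_mul {f g : ℝ × ℝ → ℝ} {q : ℝ × ℝ}
    (hf : AnalyticAt ℝ f q) (hg : AnalyticAt ℝ g q) :
    pv (f * g) =ᶠ[𝓝 q] pv f * g + f * pv g := by
  filter_upwards [eventually_differentiableAt hf, eventually_differentiableAt hg] with x h1 h2
  simp [pv, fderiv_mul h1 h2]
  ring

theorem pu_pv_comm {f : ℝ × ℝ → V} {q : ℝ × ℝ} [CompleteSpace V] (hf : AnalyticAt ℝ f q) :
    pv (pu f) =ᶠ[𝓝 q] pu (pv f) := by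
  filter_upwards [hf.eventually_analyticAt] with x hx
  have hd := hx.fderiv.differentiableAt
  have h1 : ∀ w v : ℝ × ℝ, fderiv ℝ (fun y => fderiv ℝ f y w) x v = fderiv ℝ (fderiv ℝ f) x v w :=
    fun w v => by
      rw [fderiv_clm_apply hd (differentiableAt_const w)]
      simp
  have h2 : IsSymmSndFDerivAt ℝ f x := hx.contDiffAt.isSymmSndFDerivAt_of_omega
  exact ((h1 _ _).trans (h2 _ _)).trans (h1 _ _).symm

theorem pu_iterate_congr {f g : ℝ × ℝ → V} {q : ℝ × ℝ} (h : f =ᶠ[𝓝 q] g) (n : ℕ) :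
    pu^[n] f =ᶠ[𝓝 q] pu^[n] g := by
  induction n generalizing f g with
  | zero => exact h
  | succ n ih => exact ih (pu_congr h)

theorem pv_iterate_congr {f g : ℝ × ℝ → V} {q : ℝ × ℝ} (h : f =ᶠ[𝓝 q] g) (n : ℕ) :
    pv^[n] f =ᶠ[𝓝 q] pv^[n] g := by
  induction n generalizing f g with
  | zero => exact h
  | succ n ih => exact ih (pv_congr h)

theorem pv_iterate_pu {f : ℝ × ℝ → V} {q : ℝ × ℝ} [CompleteSpace V] (hf : AnalyticAt ℝ f q)
    (n : ℕ) : pv^[n] (pu f) =ᶠ[𝓝 q] pu (pv^[n] f) := by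
  induction n generalizing f with
  | zero => exact EventuallyEq.rfl
  | succ n ih => exact (pv_iterate_congr (pu_pv_comm hf) n).trans (ih (analyticAt_pv hf))

end PartialDerivatives

namespace BiSeries

/-! ### Taylor series -/

/-- The Taylor series at the origin. -/
def jet (f : ℝ × ℝ → ℝ) : BiSeries :=
  PowerSeries.mk fun k => PowerSeries.mk fun j => (pu^[j] (pv^[k] f)) 0 / (j ! * k !)

theorem bc_jet (j k : ℕ) (f : ℝ × ℝ → ℝ) :
    bc j k (jet f) = (pu^[j] (pv^[k] f)) 0 / (j ! * k !) := by
  simp [bc, jet]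

theorem bc_zero_jet (f : ℝ × ℝ → ℝ) : bc 0 0 (jet f) = f 0 := by
  simp [bc_jet]

theorem jet_congr {f g : ℝ × ℝ → ℝ} (h : f =ᶠ[𝓝 0] g) : jet f = jet g := by
  ext j k
  rw [bc_jet, bc_jet, (pu_iterate_congr (pv_iterate_congr h k) j).eq_of_nhds]

theorem jet_pv (f : ℝ × ℝ → ℝ) : jet (pv f) = dv (jet f) := by
  ext j k
  rw [bc_dv, bc_jet, bc_jet, Nat.factorial_succ]
  push_cast
  rw [Function.iterate_succ_apply]
  field_simp

theorem jet_pu {f : ℝ × ℝ → ℝ} (hf : AnalyticAt ℝ f 0) : jet (pu f) = du (jet f) := by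
  ext j k
  rw [bc_du, bc_jet, bc_jet, Nat.factorial_succ,
    (pu_iterate_congr (pv_iterate_pu hf k) j).eq_of_nhds, Function.iterate_succ_apply]
  push_cast
  field_simp

/-- Induction principle to prove identities between formal series. -/
theorem eq_zero_of_closed (S : Set BiSeries) (hu : ∀ a ∈ S, du a ∈ S) (hv : ∀ a ∈ S, dv a ∈ S)
    (h0 : ∀ a ∈ S, bc 0 0 a = 0) {a : BiSeries} (ha : a ∈ S) : a = 0 := by
  have key : ∀ k j, ∀ a ∈ S, bc j k a = 0 := by
    intro k
    induction k with
    | zero =>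
      intro j
      induction j with
      | zero => exact h0
      | succ j ih =>
        intro a ha
        have := ih _ (hu a ha)
        rw [bc_du] at this
        exact (mul_eq_zero.1 this).resolve_right (by positivity)
    | succ k ih =>
      intro j a ha
      have := ih j _ (hv a ha)
      rw [bc_dv] at this
      exact (mul_eq_zero.1 this).resolve_right (by positivity)
  ext j k
  rw [key k j a ha]
  simp [bc]

theorem jet_add {f g : ℝ × ℝ → ℝ} (hf : AnalyticAt ℝ f 0) (hg : AnalyticAt ℝ g 0) :
    jet (f + g) = jet f + jet g := by
  refine sub_eq_zero.1 (eq_zero_of_closed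
    {a | ∃ f g, AnalyticAt ℝ f 0 ∧ AnalyticAt ℝ g 0 ∧ jet (f + g) - (jet f + jet g) = a}
    ?_ ?_ ?_ ⟨f, g, hf, hg, rfl⟩)
  · rintro _ ⟨f, g, hf, hg, rfl⟩
    refine ⟨pu f, pu g, analyticAt_pu hf, analyticAt_pu hg, ?_⟩
    rw [← jet_congr (pu_add hf hg), jet_pu hf, jet_pu hg, jet_pu (hf.add hg), du_sub, du_add]
  · rintro _ ⟨f, g, hf, hg, rfl⟩
    refine ⟨pv f, pv g, analyticAt_pv hf, analyticAt_pv hg, ?_⟩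
    rw [← jet_congr (pv_add hf hg), jet_pv f, jet_pv g, jet_pv (f + g), dv_sub, dv_add]
  · rintro _ ⟨f, g, hf, hg, rfl⟩
    simp [bc_sub, bc_add, bc_zero_jet]

theorem jet_smul (c : ℝ) {f : ℝ × ℝ → ℝ} (hf : AnalyticAt ℝ f 0) :
    jet (c • f) = c • jet f := by
  refine sub_eq_zero.1 (eq_zero_of_closed
    {a | ∃ f, AnalyticAt ℝ f 0 ∧ jet (c • f) - c • jet f = a} ?_ ?_ ?_ ⟨f, hf, rfl⟩)
  · rintro _ ⟨f, hf, rfl⟩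
    refine ⟨pu f, analyticAt_pu hf, ?_⟩
    rw [← pu_smul, jet_pu hf, jet_pu hf.const_smul, du_sub, du_smul]
  · rintro _ ⟨f, hf, rfl⟩
    refine ⟨pv f, analyticAt_pv hf, ?_⟩
    rw [← pv_smul, jet_pv f, jet_pv, dv_sub, dv_smul]
  · rintro _ ⟨f, hf, rfl⟩
    simp [bc_sub, bc_smul, bc_zero_jet]

theorem jet_sub {f g : ℝ × ℝ → ℝ} (hf : AnalyticAt ℝ f 0) (hg : AnalyticAt ℝ g 0) :
    jet (f - g) = jet f - jet g := by
  have h : f - g = f + (-1 : ℝ) • g := by simp [sub_eq_add_neg]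
  rw [h, jet_add hf hg.const_smul, jet_smul _ hg]
  simp [sub_eq_add_neg]

theorem jet_mul {f g : ℝ × ℝ → ℝ} (hf : AnalyticAt ℝ f 0) (hg : AnalyticAt ℝ g 0) :
    jet (f * g) = jet f * jet g := by
  set T := {a | ∃ f g, AnalyticAt ℝ f 0 ∧ AnalyticAt ℝ g 0 ∧ jet (f * g) - jet f * jet g = a}
  have h0 : ∀ D : BiSeries →+ BiSeries,
      (∀ a ∈ T, D a ∈ AddSubgroup.closure T) →
      ∀ a ∈ AddSubgroup.closure T, D a ∈ AddSubgroup.closure T := fun D hD => by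
    have : AddSubgroup.closure T ≤ (AddSubgroup.closure T).comap D :=
      (AddSubgroup.closure_le _).2 hD
    exact this
  refine sub_eq_zero.1 (eq_zero_of_closed (AddSubgroup.closure T : Set BiSeries)
    (h0 ⟨⟨du, ?_⟩, du_add⟩ ?_) (h0 ⟨⟨dv, ?_⟩, dv_add⟩ ?_) ?_
    (AddSubgroup.subset_closure ⟨f, g, hf, hg, rfl⟩))
  · simpa using du_sub 0 0
  · rintro _ ⟨f, g, hf, hg, rfl⟩
    have hf' := analyticAt_pu hf
    have hg' := analyticAt_pu hg
    have : du (jet (f * g) - jet f * jet g) =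
        (jet (pu f * g) - jet (pu f) * jet g) + (jet (f * pu g) - jet f * jet (pu g)) := by
      rw [du_sub, ← jet_pu (hf.mul hg), du_mul, jet_congr (pu_mul hf hg),
        jet_add (hf'.mul hg) (hf.mul hg'), jet_pu hf, jet_pu hg]
      ring
    change du _ ∈ _
    rw [this]
    exact add_mem (AddSubgroup.subset_closure ⟨_, _, hf', hg, rfl⟩)
      (AddSubgroup.subset_closure ⟨_, _, hf, hg', rfl⟩)
  · simpa using dv_sub 0 0
  · rintro _ ⟨f, g, hf, hg, rfl⟩
    have hf' := analyticAt_pv hf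
    have hg' := analyticAt_pv hg
    have : dv (jet (f * g) - jet f * jet g) =
        (jet (pv f * g) - jet (pv f) * jet g) + (jet (f * pv g) - jet f * jet (pv g)) := by
      rw [dv_sub, ← jet_pv (f * g), dv_mul, jet_congr (pv_mul hf hg),
        jet_add (hf'.mul hg) (hf.mul hg'), jet_pv f, jet_pv g]
      ring
    change dv _ ∈ _
    rw [this]
    exact add_mem (AddSubgroup.subset_closure ⟨_, _, hf', hg, rfl⟩)
      (AddSubgroup.subset_closure ⟨_, _, hf, hg', rfl⟩)
  · intro a ha
    induction ha using AddSubgroup.closure_induction with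
    | mem a ha =>
      obtain ⟨f, g, hf, hg, rfl⟩ := ha
      simp [bc_sub, bc_mul, bc_zero_jet]
    | zero => simp [bc]
    | add a b _ _ ha hb => rw [bc_add, ha, hb, add_zero]
    | neg a _ ha => simpa [bc] using ha

theorem jet_const (c : ℝ) : jet (fun _ => c) = C (C c) := by
  have hu : ∀ c : ℝ, pu (fun _ : ℝ × ℝ => c) = fun _ => 0 := fun c => by funext; simp [pu]
  have hv : ∀ c : ℝ, pv (fun _ : ℝ × ℝ => c) = fun _ => 0 := fun c => by funext; simp [pv]
  have h0 : jet (fun _ => 0) = 0 := by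
    refine eq_zero_of_closed {jet fun _ => 0} ?_ ?_ ?_ rfl
    · rintro _ rfl; rw [← jet_pu analyticAt_const, hu]; rfl
    · rintro _ rfl; rw [← jet_pv, hv]; rfl
    · rintro _ rfl; rw [bc_zero_jet]
  have hd : dv (jet (fun _ => c)) = 0 := by rw [← jet_pv, hv, h0]
  have hd' : du (jet (fun _ => c)) = 0 := by rw [← jet_pu analyticAt_const, hu, h0]
  refine ext_bc fun j k => ?_
  cases k with
  | succ k =>
    have := bc_dv j k (jet fun _ => c)
    rw [hd] at this
    simpa [bc, coeff_C, Nat.cast_add_one_ne_zero] using this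
  | zero =>
    cases j with
    | zero => rw [bc_zero_jet]; simp [bc]
    | succ j =>
      have := bc_du j 0 (jet fun _ => c)
      rw [hd'] at this
      simpa [bc, coeff_C, Nat.cast_add_one_ne_zero] using this

/-- An analytic function with vanishing Taylor series vanishes near the origin. -/
theorem eventuallyEq_zero_of_jet_eq_zero {f : ℝ × ℝ → ℝ} (hf : AnalyticAt ℝ f 0)
    (h : jet f = 0) : f =ᶠ[𝓝 0] 0 := by
  have key : ∀ (y : ℝ × ℝ) (n : ℕ) (f : ℝ × ℝ → ℝ), AnalyticAt ℝ f 0 → jet f = 0 →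
      iteratedFDeriv ℝ n f 0 (fun _ => y) = 0 := by
    intro y n
    induction n with
    | zero =>
      intro f _ h
      rw [iteratedFDeriv_zero_apply, ← bc_zero_jet f, h]
      simp [bc]
    | succ n ih =>
      intro f hf h
      have e1 : (fun x => fderiv ℝ f x y) = y.1 • pu f + y.2 • pv f := by
        funext x
        have : y = y.1 • (1, 0) + y.2 • (0, 1) := by ext <;> simp
        conv_lhs => rw [this]
        rw [map_add, map_smul, map_smul]
        rfl
      have hu := analyticAt_pu hf
      have hv := analyticAt_pv hf
      have e2 : jet (y.1 • pu f + y.2 • pv f) = 0 := by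
        have h1 : du (0 : BiSeries) = 0 := by simpa using du_sub 0 0
        have h2 : dv (0 : BiSeries) = 0 := map_zero _
        rw [jet_add hu.const_smul hv.const_smul, jet_smul _ hu, jet_smul _ hv, jet_pu hf, jet_pv f,
          h, h1, h2, smul_zero, smul_zero, add_zero]
      have h3 := ih _ (hu.const_smul.add hv.const_smul) e2
      rw [← e1] at h3
      have h4 := (ContinuousLinearMap.apply ℝ ℝ y).iteratedFDeriv_comp_left
        (hf.fderiv.contDiffAt (n := ⊤)) (i := n) le_top
      rw [iteratedFDeriv_succ_apply_right]
      have h5 := congrArg (fun m => m (fun _ => y)) h4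
      exact h5.symm.trans h3
  obtain ⟨p, r, hp⟩ := hf
  filter_upwards [Metric.eball_mem_nhds 0 hp.r_pos] with y hy
  have := hp.hasSum_iteratedFDeriv hy
  simp only [key y _ f ⟨p, r, hp⟩ h, smul_zero, zero_add] at this
  exact this.unique hasSum_zero

theorem eventuallyEq_of_jet_eq {f g : ℝ × ℝ → ℝ} (hf : AnalyticAt ℝ f 0) (hg : AnalyticAt ℝ g 0)
    (h : jet f = jet g) : f =ᶠ[𝓝 0] g := by
  have := eventuallyEq_zero_of_jet_eq_zero (hf.sub hg) (by rw [jet_sub hf hg, h, sub_self])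
  exact this.mono fun x hx => sub_eq_zero.1 hx

theorem norm_pu_iterate_pv_iterate_le {f : ℝ × ℝ → ℝ} (hf : AnalyticAt ℝ f 0) (j k : ℕ) :
    ‖(pu^[j] (pv^[k] f)) 0‖ ≤ ‖iteratedFDeriv ℝ (j + k) f 0‖ := by
  have key : ∀ (c : ℝ × ℝ) (f : ℝ × ℝ → ℝ) (n : ℕ), ‖c‖ ≤ 1 → AnalyticAt ℝ f 0 →
      ‖iteratedFDeriv ℝ n (fun x => fderiv ℝ f x c) 0‖ ≤ ‖iteratedFDeriv ℝ (n + 1) f 0‖ := by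
    intro c f n hc hf
    rw [← norm_iteratedFDeriv_fderiv]
    refine (norm_iteratedFDeriv_clm_apply_const (hf.fderiv.contDiffAt (n := ⊤)) le_top).trans ?_
    exact mul_le_of_le_one_left (norm_nonneg _) hc
  have hu : ∀ (n j : ℕ) (f : ℝ × ℝ → ℝ), AnalyticAt ℝ f 0 →
      ‖iteratedFDeriv ℝ n (pu^[j] f) 0‖ ≤ ‖iteratedFDeriv ℝ (j + n) f 0‖ := by
    intro n j
    induction j with
    | zero => intro f _; rw [zero_add]; rfl
    | succ j ih =>
      intro f hf
      refine (ih _ (analyticAt_pu hf)).trans ?_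
      have := key (1, 0) f (j + n) (by simp [Prod.norm_def]) hf
      rwa [show j + 1 + n = j + n + 1 by ring]
  have hv : ∀ (n k : ℕ) (f : ℝ × ℝ → ℝ), AnalyticAt ℝ f 0 →
      ‖iteratedFDeriv ℝ n (pv^[k] f) 0‖ ≤ ‖iteratedFDeriv ℝ (n + k) f 0‖ ∧
        AnalyticAt ℝ (pv^[k] f) 0 := by
    intro n k
    induction k with
    | zero => intro f hf; exact ⟨by simp, hf⟩
    | succ k ih =>
      intro f hf
      refine ⟨(ih _ (analyticAt_pv hf)).1.trans ?_, (ih _ (analyticAt_pv hf)).2⟩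
      exact key (0, 1) f (n + k) (by simp [Prod.norm_def]) hf
  have h := hu 0 j _ (hv 0 k f hf).2
  rw [norm_iteratedFDeriv_zero] at h
  exact h.trans (hv j k f hf).1

theorem norm_iteratedFDeriv_le_of_hasFPowerSeriesOnBall {f : ℝ × ℝ → ℝ}
    {p : FormalMultilinearSeries ℝ (ℝ × ℝ) ℝ} {r : ℝ≥0∞} (hp : HasFPowerSeriesOnBall f p 0 r)
    (n : ℕ) : ‖iteratedFDeriv ℝ n f 0‖ ≤ n ! * ‖p n‖ := by
  refine ContinuousMultilinearMap.opNorm_le_bound (by positivity) fun m => ?_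
  rw [hp.iteratedFDeriv_eq_sum_of_completeSpace]
  calc _ ≤ ∑ σ : Equiv.Perm (Fin n), ‖p n fun i => m (σ i)‖ := norm_sum_le _ _
    _ ≤ ∑ σ : Equiv.Perm (Fin n), ‖p n‖ * ∏ i, ‖m i‖ := by
        refine sum_le_sum fun σ _ => ?_
        rw [← Equiv.prod_comp σ fun i => ‖m i‖]
        exact (p n).le_opNorm _
    _ = _ := by
        rw [sum_const, card_univ, Fintype.card_perm, Fintype.card_fin, nsmul_eq_mul, mul_assoc]

/-- Taylor series have finite weighted norm. -/
theorem exists_wnorm_jet_lt_top {f : ℝ × ℝ → ℝ} (hf : AnalyticAt ℝ f 0) :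
    ∃ R₀ : ℝ≥0, 0 < R₀ ∧ ∀ R ≤ R₀, wnorm R 1 (jet f) < ⊤ := by
  obtain ⟨p, r, hp⟩ := hf
  obtain ⟨ρ, hρ0, hρ⟩ := ENNReal.lt_iff_exists_nnreal_btwn.1 (hp.r_pos.trans_le hp.r_le)
  rw [ENNReal.coe_pos] at hρ0
  obtain ⟨M, -, hM⟩ := p.norm_mul_pow_le_of_lt_radius hρ
  lift M to ℝ≥0 using le_trans (by positivity) (hM 0)
  refine ⟨ρ / 2, by positivity, fun R hR => ?_⟩
  have hb : ∀ j k, wt R 1 j k * ‖bc j k (jet f)‖₊ ≤ M * ((1 / 2) ^ j * (1 / 2) ^ k) := by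
    intro j k
    rw [← NNReal.coe_le_coe]
    have h1 := norm_pu_iterate_pv_iterate_le ⟨p, r, hp⟩ j k
    have h2 := norm_iteratedFDeriv_le_of_hasFPowerSeriesOnBall hp (j + k)
    have h3 : ((j + k).choose k : ℝ) * (j ! * k !) = (j + k)! := by
      have := Nat.add_choose_mul_factorial_mul_factorial j k
      rw [mul_assoc] at this
      exact_mod_cast this
    have hc : (0 : ℝ) < (j + k).choose k := by
      exact_mod_cast Nat.choose_pos (Nat.le_add_left k j)
    have h4 : ‖bc j k (jet f)‖ ≤ (j + k).choose k * ‖p (j + k)‖ := by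
      have : ‖(j ! * k ! : ℝ)‖ = j ! * k ! := by
        rw [Real.norm_of_nonneg (by positivity)]
      rw [bc_jet, norm_div, this, div_le_iff₀ (by positivity)]
      refine (h1.trans h2).trans (le_of_eq ?_)
      rw [← h3]
      ring
    have hR' : (R : ℝ) ≤ ρ / 2 := by exact_mod_cast hR
    push_cast [wt]
    calc (R : ℝ) ^ (j + k) * 1 ^ k / (j + k).choose k * ‖bc j k (jet f)‖
        ≤ (R : ℝ) ^ (j + k) * 1 ^ k / (j + k).choose k *
            ((j + k).choose k * ‖p (j + k)‖) := by gcongr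
      _ = (R : ℝ) ^ (j + k) * ‖p (j + k)‖ := by rw [one_pow]; field_simp
      _ ≤ (ρ / 2 : ℝ) ^ (j + k) * ‖p (j + k)‖ := by gcongr
      _ = ‖p (j + k)‖ * ρ ^ (j + k) * ((1 / 2) ^ j * (1 / 2) ^ k) := by
          rw [div_pow, ← pow_add, one_div, inv_pow]; ring
      _ ≤ M * ((1 / 2) ^ j * (1 / 2) ^ k) := by
          gcongr
          exact hM _
  have hs : ∑' n : ℕ, ((1 / 2 : ℝ≥0) : ℝ≥0∞) ^ n < ⊤ := by
    rw [ENNReal.tsum_geometric, ENNReal.inv_lt_top, tsub_pos_iff_lt]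
    exact_mod_cast NNReal.half_lt_self one_ne_zero
  refine (ENNReal.tsum_le_tsum fun k => ENNReal.tsum_le_tsum fun j =>
    ENNReal.coe_le_coe.2 (hb j k)).trans_lt ?_
  simp only [ENNReal.coe_mul, ENNReal.coe_pow, ENNReal.tsum_mul_left, ENNReal.tsum_mul_right]
  exact ENNReal.mul_lt_top ENNReal.coe_lt_top (ENNReal.mul_lt_top hs hs)

/-- The multilinear series of a formal series in two variables. -/
def ser (a : BiSeries) : FormalMultilinearSeries ℝ (ℝ × ℝ) ℝ := fun n =>
  ∑ p ∈ antidiagonal n, bc p.1 p.2 a •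
    (ContinuousMultilinearMap.mkPiAlgebra ℝ (Fin n) ℝ).compContinuousLinearMap fun i =>
      if (i : ℕ) < p.1 then ContinuousLinearMap.fst ℝ ℝ ℝ else ContinuousLinearMap.snd ℝ ℝ ℝ

theorem ser_apply (a : BiSeries) (n : ℕ) (y : ℝ × ℝ) :
    (ser a n fun _ => y) = ∑ p ∈ antidiagonal n, bc p.1 p.2 a * (y.1 ^ p.1 * y.2 ^ p.2) := by
  rw [ser, _root_.sum_apply]
  refine sum_congr rfl fun p hp => ?_
  rw [_root_.smul_apply,
    ContinuousMultilinearMap.compContinuousLinearMap_apply,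
    ContinuousMultilinearMap.mkPiAlgebra_apply, smul_eq_mul]
  congr 1
  have h : ∀ i : Fin n, (if (i : ℕ) < p.1 then ContinuousLinearMap.fst ℝ ℝ ℝ
      else ContinuousLinearMap.snd ℝ ℝ ℝ) y = if (i : ℕ) < p.1 then y.1 else y.2 := by
    intro i; split_ifs <;> rfl
  simp only [h]
  rw [Fin.prod_univ_eq_prod_range (fun i => if i < p.1 then y.1 else y.2) n,
    ← HasAntidiagonal.mem_antidiagonal.1 hp, prod_range_add]
  congr 1
  · rw [prod_congr rfl fun i hi => if_pos (mem_range.1 hi)]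
    simp
  · simp

theorem norm_ser_le (a : BiSeries) (n : ℕ) :
    ‖ser a n‖ ≤ ∑ p ∈ antidiagonal n, ‖bc p.1 p.2 a‖ := by
  refine (norm_sum_le _ _).trans (sum_le_sum fun p _ => ?_)
  rw [norm_smul]
  refine mul_le_of_le_one_right (norm_nonneg _) ?_
  refine (ContinuousMultilinearMap.norm_compContinuousLinearMap_le _ _).trans ?_
  rw [ContinuousMultilinearMap.norm_mkPiAlgebra, one_mul]
  refine prod_le_one (fun _ _ => norm_nonneg _) fun i _ => ?_
  split_ifs
  · exact ContinuousLinearMap.norm_fst_le ..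
  · exact ContinuousLinearMap.norm_snd_le ..

/-- Convergence of a formal series in a neighborhood of the origin. -/
def Conv (a : BiSeries) : Prop :=
  ∃ ρ M : ℝ≥0, 0 < ρ ∧ ∀ j k, ‖bc j k a‖₊ * ρ ^ (j + k) ≤ M

theorem conv_of_wnorm_lt_top {R δ : ℝ≥0} (hR : 0 < R) (hδ : 0 < δ) (hδ1 : δ ≤ 1) {a : BiSeries}
    (h : wnorm R δ a < ⊤) : Conv a := by
  refine ⟨R * δ / 2, (wnorm R δ a).toNNReal, by positivity, fun j k => ?_⟩
  rw [← ENNReal.coe_le_coe, ENNReal.coe_toNNReal h.ne]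
  have h1 : ((wt R δ j k * ‖bc j k a‖₊ : ℝ≥0) : ℝ≥0∞) ≤ wnorm R δ a :=
    (ENNReal.le_tsum (f := fun j => ((wt R δ j k * ‖bc j k a‖₊ : ℝ≥0) : ℝ≥0∞)) j).trans
      (ENNReal.le_tsum (f := fun k => ∑' j, ((wt R δ j k * ‖bc j k a‖₊ : ℝ≥0) : ℝ≥0∞)) k)
  refine le_trans (ENNReal.coe_le_coe.2 ?_) h1
  rw [mul_comm]
  refine mul_le_mul_left (a := ‖bc j k a‖₊) ?_
  rw [wt, div_pow, mul_pow]
  have h2 : ((j + k).choose k : ℝ≥0) ≤ 2 ^ (j + k) := by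
    exact_mod_cast Nat.choose_le_two_pow (j + k) k
  have h3 : (0 : ℝ≥0) < (j + k).choose k := by
    exact_mod_cast Nat.choose_pos (Nat.le_add_left k j)
  have h4 : δ ^ (j + k) ≤ δ ^ k := pow_le_pow_of_le_one zero_le hδ1 (Nat.le_add_left k j)
  gcongr

theorem hasFPowerSeriesOnBall_ser {a : BiSeries} (h : Conv a) :
    0 < (ser a).radius ∧ HasFPowerSeriesOnBall (ser a).sum (ser a) 0 (ser a).radius := by
  obtain ⟨ρ, M, hρ, hM⟩ := h
  have h1 : ((ρ / 2 : ℝ≥0) : ℝ≥0∞) ≤ (ser a).radius := by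
    refine (ser a).le_radius_of_bound M fun n => ?_
    have h2 : ∀ p ∈ antidiagonal n, ‖bc p.1 p.2 a‖ * (ρ : ℝ) ^ n ≤ M := fun p hp => by
      rw [← HasAntidiagonal.mem_antidiagonal.1 hp]
      exact_mod_cast hM p.1 p.2
    have h3 : ((n : ℝ) + 1) ≤ 2 ^ n := by exact_mod_cast Nat.lt_two_pow_self
    calc ‖ser a n‖ * ((ρ / 2 : ℝ≥0) : ℝ) ^ n
        ≤ (∑ p ∈ antidiagonal n, ‖bc p.1 p.2 a‖) * ((ρ / 2 : ℝ≥0) : ℝ) ^ n := by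
          gcongr; exact norm_ser_le a n
      _ = (∑ p ∈ antidiagonal n, ‖bc p.1 p.2 a‖ * (ρ : ℝ) ^ n) / 2 ^ n := by
          push_cast; rw [sum_mul, sum_div]
          refine sum_congr rfl fun _ _ => ?_
          rw [div_pow, mul_div_assoc]
      _ ≤ ((n + 1) * M) / 2 ^ n := by
          gcongr
          refine (sum_le_card_nsmul _ _ _ h2).trans ?_
          rw [Nat.card_antidiagonal, nsmul_eq_mul]
          push_cast; rfl
      _ ≤ M := by
          rw [div_le_iff₀ (by positivity), mul_comm]
          gcongr
  have h0 : 0 < (ser a).radius := lt_of_lt_of_le (by rw [ENNReal.coe_pos]; positivity) h1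
  exact ⟨h0, (ser a).hasFPowerSeriesOnBall h0⟩

theorem analyticAt_ser_sum {a : BiSeries} (h : Conv a) : AnalyticAt ℝ (ser a).sum 0 :=
  (hasFPowerSeriesOnBall_ser h).2.analyticAt

theorem eventually_hasSum_ser {a : BiSeries} (h : Conv a) :
    ∀ᶠ y in 𝓝 (0 : ℝ × ℝ), HasSum (fun n => ser a n fun _ => y) ((ser a).sum y) := by
  obtain ⟨h0, hs⟩ := hasFPowerSeriesOnBall_ser h
  filter_upwards [Metric.eball_mem_nhds 0 h0] with y hy
  simpa using hs.hasSum hy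

theorem eq_add_mul_of_hasSum {s t : ℕ → ℝ} {S T w : ℝ} (hs : HasSum s S) (ht : HasSum t T)
    (h : ∀ n, s (n + 1) = w * t n) : S = s 0 + w * T := by
  have h1 := (hasSum_nat_add_iff' 1).2 hs
  simp only [h, sum_range_one] at h1
  linarith [h1.unique (ht.mul_left w)]

theorem eq_of_du_dv {a b : BiSeries} (hu : du a = du b) (hv : dv a = dv b)
    (h0 : bc 0 0 a = bc 0 0 b) : a = b := by
  have z1 : du (0 : BiSeries) = 0 := by simpa using du_sub 0 0
  have z2 : dv (0 : BiSeries) = 0 := map_zero _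
  refine sub_eq_zero.1 (eq_zero_of_closed {a - b, 0} ?_ ?_ ?_ (Set.mem_insert _ _))
  · rintro _ (rfl | rfl)
    · right; rw [du_sub, hu, sub_self]; rfl
    · right; exact z1
  · rintro _ (rfl | rfl)
    · right; rw [dv_sub, hv, sub_self]; rfl
    · right; exact z2
  · rintro _ (rfl | rfl)
    · rw [bc_sub, h0, sub_self]
    · simp [bc]

theorem jet_fst : jet Prod.fst = C X := by
  have hu : pu (Prod.fst : ℝ × ℝ → ℝ) = fun _ => 1 := by funext; simp [pu, fderiv_fst]
  have hv : pv (Prod.fst : ℝ × ℝ → ℝ) = fun _ => 0 := by funext; simp [pv, fderiv_fst]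
  refine eq_of_du_dv ?_ ?_ ?_
  · rw [← jet_pu analyticAt_fst, hu, jet_const]
    refine PowerSeries.ext fun k => ?_
    rw [du, coeff_mk, coeff_C, coeff_C]
    split_ifs <;> simp
  · rw [← jet_pv, hv, jet_const]
    simp [dv]
  · rw [bc_zero_jet]; simp [bc]

theorem jet_snd : jet Prod.snd = X := by
  have hu : pu (Prod.snd : ℝ × ℝ → ℝ) = fun _ => 0 := by funext; simp [pu, fderiv_snd]
  have hv : pv (Prod.snd : ℝ × ℝ → ℝ) = fun _ => 1 := by funext; simp [pv, fderiv_snd]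
  refine eq_of_du_dv ?_ ?_ ?_
  · rw [← jet_pu analyticAt_snd, hu, jet_const]
    refine PowerSeries.ext fun k => ?_
    rw [du, coeff_mk, coeff_X]
    split_ifs <;> simp
  · rw [← jet_pv, hv, jet_const]
    simp [dv]
  · rw [bc_zero_jet]; simp [bc]

/-- The series obtained by dropping the terms of degree zero in `v` and dividing by `v`. -/
def shift (a : BiSeries) : BiSeries := PowerSeries.mk fun k => coeff (k + 1) a

theorem bc_shift (j k : ℕ) (a : BiSeries) : bc j k (shift a) = bc j (k + 1) a := by
  simp [bc, shift]

theorem bc_C (j k : ℕ) (b : ℝ⟦X⟧) : bc j k (C b) = if k = 0 then coeff j b else 0 := by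
  rw [bc, coeff_C]
  split_ifs <;> simp

theorem conv_shift {a : BiSeries} (h : Conv a) : Conv (shift a) := by
  obtain ⟨ρ, M, hρ, hM⟩ := h
  refine ⟨ρ, M / ρ, hρ, fun j k => ?_⟩
  rw [bc_shift, le_div_iff₀ hρ, mul_assoc, ← pow_succ]
  exact hM j (k + 1)

theorem conv_C_constantCoeff {a : BiSeries} (h : Conv a) : Conv (C (constantCoeff a)) := by
  obtain ⟨ρ, M, hρ, hM⟩ := h
  refine ⟨ρ, M, hρ, fun j k => ?_⟩
  rw [bc_C]
  split_ifs with hk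
  · subst hk
    simpa [bc] using hM j 0
  · simp

theorem conv_C_mk_coeff_succ {b : ℝ⟦X⟧} (h : Conv (C b)) :
    Conv (C (PowerSeries.mk fun j => coeff (j + 1) b)) := by
  obtain ⟨ρ, M, hρ, hM⟩ := h
  refine ⟨ρ, M / ρ, hρ, fun j k => ?_⟩
  rw [le_div_iff₀ hρ, mul_assoc, ← pow_succ, bc_C, coeff_mk]
  have := hM (j + 1) k
  rw [bc_C] at this
  rwa [show j + k + 1 = j + 1 + k by ring]

theorem ser_zero_apply (a : BiSeries) (y : ℝ × ℝ) : (ser a 0 fun _ => y) = bc 0 0 a := by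
  simp [ser_apply]

theorem jet_ser_sum_C {b : ℝ⟦X⟧} (h : Conv (C b)) : jet (ser (C b)).sum = C b := by
  have key : ∀ j k b, Conv (C b) → bc j k (jet (ser (C b)).sum) = bc j k (C b) := by
    have split : ∀ b, Conv (C b) → jet (ser (C b)).sum = C (C (coeff 0 b)) +
        C X * jet (ser (C (PowerSeries.mk fun j => coeff (j + 1) b))).sum := fun b h => by
      have h' := conv_C_mk_coeff_succ h
      have ha := analyticAt_ser_sum h'
      rw [← jet_fst, ← jet_const, ← jet_mul analyticAt_fst ha,
        ← jet_add analyticAt_const (analyticAt_fst.mul ha)]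
      refine jet_congr ?_
      filter_upwards [eventually_hasSum_ser h, eventually_hasSum_ser h'] with y h1 h2
      refine (eq_add_mul_of_hasSum (w := y.1) h1 h2 fun n => ?_).trans ?_
      · rw [ser_apply, ser_apply, Finset.Nat.sum_antidiagonal_succ, mul_sum]
        simp only [bc_C, coeff_mk, Nat.succ_ne_zero, if_false, zero_mul, zero_add]
        refine sum_congr rfl fun p _ => ?_
        ring
      · rw [ser_zero_apply, bc_C]
        rfl
    intro j
    induction j with
    | zero =>
      intro k b h
      rw [split b h, bc_add, bc_C, bc_C]
      simp [bc, coeff_C_mul]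
    | succ j ih =>
      intro k b h
      rw [split b h, bc_add, bc_C, bc_C]
      have := ih k _ (conv_C_mk_coeff_succ h)
      rw [bc_C, coeff_mk] at this
      rw [← this]
      simp [bc, coeff_C_mul, coeff_succ_X_mul]
  exact ext_bc fun j k => key j k b h

/-- The Taylor series of the sum of a convergent formal series is the given series. -/
theorem jet_ser_sum {a : BiSeries} (h : Conv a) : jet (ser a).sum = a := by
  have key : ∀ k j a, Conv a → bc j k (jet (ser a).sum) = bc j k a := by
    have split : ∀ a, Conv a → jet (ser a).sum = C (constantCoeff a) +
        X * jet (ser (shift a)).sum := fun a h => by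
      have h' := conv_shift h
      have h0 := conv_C_constantCoeff h
      have ha := analyticAt_ser_sum h'
      rw [← jet_snd, ← jet_ser_sum_C h0, ← jet_mul analyticAt_snd ha,
        ← jet_add (analyticAt_ser_sum h0) (analyticAt_snd.mul ha)]
      refine jet_congr ?_
      filter_upwards [eventually_hasSum_ser h, eventually_hasSum_ser h',
        eventually_hasSum_ser h0] with y h1 h2 h3
      have := eq_add_mul_of_hasSum (w := y.2) (h1.sub h3) h2 fun n => ?_
      · rw [ser_zero_apply, ser_zero_apply, bc_C] at this
        simp only [bc, if_true, coeff_zero_eq_constantCoeff, sub_self, zero_add] at this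
        simp only [Pi.add_apply, Pi.mul_apply]
        linarith
      · rw [ser_apply, ser_apply, ser_apply, Finset.Nat.sum_antidiagonal_succ',
          Finset.Nat.sum_antidiagonal_succ', mul_sum]
        simp only [bc_C, bc_shift, Nat.succ_ne_zero, if_false, if_true, zero_mul, sum_const_zero,
          add_zero]
        rw [bc, coeff_zero_eq_constantCoeff_apply, add_sub_cancel_left]
        refine sum_congr rfl fun p _ => ?_
        ring
    intro k
    induction k with
    | zero =>
      intro j a h
      rw [split a h, bc_add, bc_C]
      simp [bc]
    | succ k ih =>
      intro j a h
      rw [split a h, bc_add, bc_C]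
      have := ih j _ (conv_shift h)
      rw [bc_shift] at this
      rw [← this]
      simp [bc, coeff_succ_X_mul]
  exact ext_bc fun j k => key k j a h

theorem constantCoeff_jet_congr {f g : ℝ × ℝ → ℝ} (hf : AnalyticAt ℝ f 0)
    (hg : AnalyticAt ℝ g 0) (h : ∀ᶠ u in 𝓝 (0 : ℝ), f (u, 0) = g (u, 0)) :
    constantCoeff (jet f) = constantCoeff (jet g) := by
  have key : ∀ (j : ℕ) (f g : ℝ × ℝ → ℝ), AnalyticAt ℝ f 0 → AnalyticAt ℝ g 0 →
      (∀ᶠ u in 𝓝 (0 : ℝ), f (u, 0) = g (u, 0)) → (pu^[j] f) 0 = (pu^[j] g) 0 := by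
    intro j
    induction j with
    | zero => exact fun f g _ _ h => h.self_of_nhds
    | succ j ih =>
      intro f g hf hg h
      refine ih _ _ (analyticAt_pu hf) (analyticAt_pu hg) ?_
      have hc : Tendsto (fun u : ℝ => (u, (0 : ℝ))) (𝓝 0) (𝓝 0) :=
        Continuous.tendsto (by fun_prop) 0
      have hd : ∀ f : ℝ × ℝ → ℝ, ∀ u : ℝ, DifferentiableAt ℝ f (u, 0) →
          pu f (u, 0) = deriv (fun t => f (t, 0)) u := fun f u hf => by
        have h1 : HasDerivAt (fun t : ℝ => (t, (0 : ℝ))) (1, 0) u :=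
          (hasDerivAt_id u).prodMk (hasDerivAt_const u 0)
        exact (hf.hasFDerivAt.comp_hasDerivAt u h1).deriv.symm
      filter_upwards [h.eventually_nhds, hc.eventually (eventually_differentiableAt hf),
        hc.eventually (eventually_differentiableAt hg)] with u h1 h2 h3
      rw [hd f u h2, hd g u h3]
      exact EventuallyEq.deriv_eq h1
  ext j
  have := key j f g hf hg h
  rw [← coeff_zero_eq_constantCoeff_apply, ← coeff_zero_eq_constantCoeff_apply]
  change bc j 0 _ = bc j 0 _
  rw [bc_jet, bc_jet]
  simp only [Function.iterate_zero, id]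
  rw [this]

theorem eventually_wnorm_jet_lt_top {f : ℝ × ℝ → ℝ} (hf : AnalyticAt ℝ f 0) :
    ∀ᶠ R in 𝓝[>] (0 : ℝ≥0), wnorm R 1 (jet f) < ⊤ := by
  obtain ⟨R₀, h0, h⟩ := exists_wnorm_jet_lt_top hf
  filter_upwards [Ioc_mem_nhdsGT h0] with R hR using h R hR.2

theorem pv_eq_zero_of_forall {f : ℝ × ℝ → ℝ} {q : ℝ × ℝ} (hf : DifferentiableAt ℝ f q)
    (h : ∀ t, f (q.1, t) = f q) : pv f q = 0 := by
  have h1 : HasDerivAt (fun t : ℝ => (q.1, t)) (0, 1) q.2 :=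
    (hasDerivAt_const q.2 q.1).prodMk (hasDerivAt_id q.2)
  have h2 := HasFDerivAt.comp_hasDerivAt q.2 (f := fun t : ℝ => (q.1, t)) hf.hasFDerivAt h1
  have h3 : (f ∘ fun t : ℝ => (q.1, t)) = fun _ => f q := funext h
  rw [h3] at h2
  exact h2.unique (hasDerivAt_const _ _)

theorem dv_jet_eq_zero {f : ℝ × ℝ → ℝ} (hf : AnalyticAt ℝ f 0)
    (h : ∀ q : ℝ × ℝ, ∀ t, f (q.1, t) = f q) : dv (jet f) = 0 := by
  have : pv f =ᶠ[𝓝 0] fun _ => 0 := by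
    filter_upwards [eventually_differentiableAt hf] with q hq using pv_eq_zero_of_forall hq (h q)
  rw [← jet_pv, jet_congr this, jet_const, map_zero, map_zero]

theorem jet_mink {a b : Fin 3 → ℝ × ℝ → ℝ} (ha : ∀ i, AnalyticAt ℝ (a i) 0)
    (hb : ∀ i, AnalyticAt ℝ (b i) 0) :
    jet (fun q => mink (fun i => a i q) fun i => b i q) =
      fm (fun i => jet (a i)) fun i => jet (b i) := by
  have h : ∀ i, AnalyticAt ℝ (a i * b i) 0 := fun i => (ha i).mul (hb i)
  have e : (fun q => mink (fun i => a i q) fun i => b i q) = a 0 * b 0 + a 1 * b 1 - a 2 * b 2 :=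
    rfl
  rw [e, jet_sub ((h 0).add (h 1)) (h 2), jet_add (h 0) (h 1), jet_mul (ha 0) (hb 0),
    jet_mul (ha 1) (hb 1), jet_mul (ha 2) (hb 2), fm]

theorem analyticAt_mink {a b : Fin 3 → ℝ × ℝ → ℝ} {q : ℝ × ℝ} (ha : ∀ i, AnalyticAt ℝ (a i) q)
    (hb : ∀ i, AnalyticAt ℝ (b i) q) :
    AnalyticAt ℝ (fun q => mink (fun i => a i q) fun i => b i q) q :=
  (((ha 0).mul (hb 0)).add ((ha 1).mul (hb 1))).sub ((ha 2).mul (hb 2))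

/-- Existence of isometric germs whose initial curve is a circle of curvature `κ`. -/
theorem exists_isometric_germ {E G : ℝ × ℝ → ℝ} (hE : AnalyticAt ℝ E 0) (hG : AnalyticAt ℝ G 0)
    (hE1 : ∀ᶠ u in 𝓝 (0 : ℝ), E (u, 0) = 1) (hG0 : ∀ᶠ u in 𝓝 (0 : ℝ), G (u, 0) = 0)
    (hEv : pv E 0 ≠ 0) {κ : ℝ} (hκ : κ ≠ 0) :
    ∃ F : Fin 3 → ℝ × ℝ → ℝ, (∀ i, AnalyticAt ℝ (F i) 0) ∧
      (∀ᶠ q in 𝓝 0, mink (fun i => pu (F i) q) (fun i => pu (F i) q) = E q ∧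
        mink (fun i => pu (F i) q) (fun i => pv (F i) q) = 0 ∧
        mink (fun i => pv (F i) q) (fun i => pv (F i) q) = G q) ∧
      (∀ i, pu (F i) 0 = ![0, 1, 0] i) ∧
      (∀ i, pv (F i) 0 = ![pv E 0 / (2 * κ), 0, pv E 0 / (2 * κ)] i) ∧
      ∀ i, pu (pu (F i)) 0 = ![-κ, 0, 0] i := by
  set s : ℝ × ℝ → ℝ := fun q => Real.sin (κ * q.1) with hs
  set c : ℝ × ℝ → ℝ := fun q => Real.cos (κ * q.1) with hc
  set l : ℝ × ℝ → ℝ := fun q => pv E (q.1, 0) / (2 * κ) with hl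
  set m : ℝ × ℝ → ℝ := fun q => 2 * κ * (pv E (q.1, 0))⁻¹ with hm
  have aκ : AnalyticAt ℝ (fun q : ℝ × ℝ => κ * q.1) 0 := analyticAt_const.mul analyticAt_fst
  have as : AnalyticAt ℝ s 0 := Real.analyticAt_sin.comp aκ
  have ac : AnalyticAt ℝ c 0 := Real.analyticAt_cos.comp aκ
  have aEv := analyticAt_pv hE
  have aaxis : AnalyticAt ℝ (fun q : ℝ × ℝ => pv E (q.1, 0)) 0 :=
    AnalyticAt.comp (g := pv E) (f := fun q : ℝ × ℝ => (q.1, (0 : ℝ))) aEv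
      (analyticAt_fst.prod analyticAt_const)
  have al : AnalyticAt ℝ l 0 := aaxis.div_const
  have am : AnalyticAt ℝ m 0 := analyticAt_const.mul (aaxis.inv hEv)
  have ak : AnalyticAt ℝ (fun _ : ℝ × ℝ => κ) 0 := analyticAt_const
  have ak' : AnalyticAt ℝ (fun _ : ℝ × ℝ => κ⁻¹) 0 := analyticAt_const
  have cc1 : ∀ t : ℝ, (C (C t) : BiSeries) = jet fun _ => t := fun t => (jet_const t).symm
  have c1 : (1 : BiSeries) = jet fun _ => 1 := by rw [← cc1, map_one, map_one]
  have c2 : (2 : BiSeries) = jet fun _ => 2 := by rw [← cc1, map_ofNat, map_ofNat]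
  have hdκ : ∀ q : ℝ × ℝ, HasFDerivAt (fun q : ℝ × ℝ => κ * q.1)
      (κ • ContinuousLinearMap.fst ℝ ℝ ℝ) q := fun q => hasFDerivAt_fst.const_mul κ
  have pus : pu s = (fun _ => κ) * c := by
    funext q
    rw [pu, ((hdκ q).sin).fderiv]
    simp [hc]; ring
  have puc : pu c = (-1 : ℝ) • ((fun _ => κ) * s) := by
    funext q
    rw [pu, ((hdκ q).cos).fderiv]
    simp [hs]; ring
  have hdu0 : ∀ t : ℝ, du (jet fun _ => t) = 0 := fun t => by
    have : pu (fun _ : ℝ × ℝ => t) = fun _ => 0 := by funext; simp [pu]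
    rw [← jet_pu analyticAt_const, this, ← cc1, map_zero, map_zero]
  have aGu := analyticAt_pu hG
  have aGv := analyticAt_pv hG
  obtain ⟨R, hR0, hR1, ns, nc, nl, nl', nm, nk, nk', nGu, nGv, nGuu, nEvv⟩ :
      ∃ R : ℝ≥0, 0 < R ∧ R ≤ 1 ∧ wnorm R 1 (jet s) < ⊤ ∧ wnorm R 1 (jet c) < ⊤ ∧
        wnorm R 1 (jet l) < ⊤ ∧ wnorm R 1 (jet (pu l)) < ⊤ ∧ wnorm R 1 (jet m) < ⊤ ∧
        wnorm R 1 (jet fun _ => κ) < ⊤ ∧ wnorm R 1 (jet fun _ => κ⁻¹) < ⊤ ∧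
        wnorm R 1 (jet (pu G)) < ⊤ ∧ wnorm R 1 (jet (pv G)) < ⊤ ∧
        wnorm R 1 (jet (pu (pu G))) < ⊤ ∧ wnorm R 1 (jet (pv (pv E))) < ⊤ := by
    have key : ∀ f : ℝ × ℝ → ℝ, AnalyticAt ℝ f 0 →
        ∀ᶠ R in 𝓝[>] (0 : ℝ≥0), wnorm R 1 (jet f) < ⊤ :=
      fun f hf => eventually_wnorm_jet_lt_top hf
    have h01 : ∀ᶠ R in 𝓝[>] (0 : ℝ≥0), R ∈ Set.Ioc 0 1 := Ioc_mem_nhdsGT one_pos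
    refine Eventually.exists (f := 𝓝[>] (0 : ℝ≥0)) ?_
    filter_upwards [h01, key _ as, key _ ac, key _ al, key _ (analyticAt_pu al), key _ am,
      key _ ak, key _ ak', key _ aGu, key _ aGv, key _ (analyticAt_pu aGu),
      key _ (analyticAt_pv aEv)] with R h h1 h2 h3 h4 h5 h6 h7 h8 h9 h10 h11
    exact ⟨h.1, h.2, h1, h2, h3, h4, h5, h6, h7, h8, h9, h10, h11⟩
  have ax0 : Tendsto (fun u : ℝ => (u, (0 : ℝ))) (𝓝 0) (𝓝 0) :=
    Continuous.tendsto (by fun_prop) 0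
  obtain ⟨δ, hδ0, hδ1, Fs, hFn, e1, e2, e3, i1, i2, i3⟩ := exists_formal_isometric hR1
    (E := jet E) (G := jet G) (s := jet s) (c := jet c) (l := jet l) (m := jet m)
    (k := jet fun _ => κ) (k' := jet fun _ => κ⁻¹)
    (by rw [← jet_pu as, pus, jet_mul ak ac])
    (by rw [← jet_pu ac, puc, jet_smul _ (ak.mul as), jet_mul ak as, neg_one_smul])
    (hdu0 _)
    (dv_jet_eq_zero as fun _ _ => rfl) (dv_jet_eq_zero ac fun _ _ => rfl)
    (dv_jet_eq_zero ak' fun _ _ => rfl) (dv_jet_eq_zero al fun _ _ => rfl)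
    (by
      rw [← jet_mul ac ac, ← jet_mul as as, ← jet_add (ac.mul ac) (as.mul as), c1]
      congr 1
      funext q
      have := Real.cos_sq_add_sin_sq (κ * q.1)
      simp only [Pi.add_apply, Pi.mul_apply, hc, hs]
      linarith)
    (by
      rw [← jet_mul al am, c1]
      refine jet_congr ?_
      filter_upwards [aaxis.continuousAt.eventually_ne hEv] with q hq
      simp only [Pi.mul_apply, hl, hm]
      field_simp)
    (by
      rw [← jet_mul ak ak', c1]
      congr 1
      funext q
      exact mul_inv_cancel₀ hκ)
    (by
      rw [constantCoeff_jet_congr hG (analyticAt_const (v := 0)) hG0, ← cc1]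
      simp)
    (by
      rw [constantCoeff_jet_congr hE (analyticAt_const (v := 1)) hE1, ← cc1]
      simp)
    (by
      rw [← jet_pv, c2, ← jet_mul ak al, ← jet_mul analyticAt_const (ak.mul al)]
      refine constantCoeff_jet_congr aEv (analyticAt_const.mul (ak.mul al))
        (Eventually.of_forall fun u => ?_)
      simp only [Pi.mul_apply, hl]
      field_simp)
    ns nc nl (by rwa [← jet_pu al]) nm nk nk' (by rwa [← jet_pu hG]) (by rwa [← jet_pv G])
    (by rwa [← jet_pu hG, ← jet_pu aGu]) (by rwa [← jet_pv E, ← jet_pv (pv E)])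
  have hconv : ∀ i, Conv (Fs i) := fun i => conv_of_wnorm_lt_top hR0 hδ0 hδ1 (hFn i)
  have hj : ∀ i, jet (ser (Fs i)).sum = Fs i := fun i => jet_ser_sum (hconv i)
  have hF : ∀ i, AnalyticAt ℝ (ser (Fs i)).sum 0 := fun i => analyticAt_ser_sum (hconv i)
  have hu := fun i => analyticAt_pu (hF i)
  have hv := fun i => analyticAt_pv (hF i)
  have ju : ∀ i, jet (pu (ser (Fs i)).sum) = du (Fs i) := fun i => by rw [jet_pu (hF i), hj]
  have jv : ∀ i, jet (pv (ser (Fs i)).sum) = dv (Fs i) := fun i => by rw [jet_pv, hj]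
  have juu : ∀ i, jet (pu (pu (ser (Fs i)).sum)) = du (du (Fs i)) := fun i => by
    rw [jet_pu (hu i), ju]
  have bc_of : ∀ {a b : BiSeries}, constantCoeff a = constantCoeff b → bc 0 0 a = bc 0 0 b :=
    fun h => by simp only [bc, coeff_zero_eq_constantCoeff_apply, h]
  have bcm : ∀ a b : BiSeries, bc 0 0 (a * b) = bc 0 0 a * bc 0 0 b := fun a b => by
    simp [bc_mul]
  have bcn : ∀ a : BiSeries, bc 0 0 (-a) = -bc 0 0 a := fun a => by simp [bc]
  have bcz : bc 0 0 (0 : BiSeries) = 0 := by simp [bc]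
  have s0 : s 0 = 0 := by simp [hs]
  have c0 : c 0 = 1 := by simp [hc]
  have l0 : l 0 = pv E 0 / (2 * κ) := rfl
  refine ⟨fun i => (ser (Fs i)).sum, hF, ?_, fun i => ?_, fun i => ?_, fun i => ?_⟩
  · refine (eventuallyEq_of_jet_eq (analyticAt_mink hu hu) hE ?_).and
      ((eventuallyEq_of_jet_eq (g := fun _ => 0) (analyticAt_mink hu hv) analyticAt_const ?_).and
        (eventuallyEq_of_jet_eq (analyticAt_mink hv hv) hG ?_))
    · rw [jet_mink hu hu]; simpa only [ju] using e1
    · rw [jet_mink hu hv, ← cc1, map_zero, map_zero]; simpa only [ju, jv] using e2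
    · rw [jet_mink hv hv]; simpa only [jv] using e3
  · rw [← bc_zero_jet (pu (ser (Fs i)).sum), ju, bc_of (i1 i)]
    fin_cases i <;> simp [bcn, bcz, bc_zero_jet, s0, c0]
  · rw [← bc_zero_jet (pv (ser (Fs i)).sum), jv, bc_of (i2 i)]
    fin_cases i <;> simp [bcm, bc_zero_jet, s0, c0, l0]
  · rw [← bc_zero_jet (pu (pu (ser (Fs i)).sum)), juu, bc_of (i3 i)]
    fin_cases i <;> simp [bcm, bcn, bcz, bc_zero_jet, s0, c0]

end BiSeries

theorem pu_pi {F : Fin 3 → ℝ × ℝ → ℝ} {q : ℝ × ℝ} (h : ∀ i, DifferentiableAt ℝ (F i) q) :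
    pu (fun q i => F i q) q = fun i => pu (F i) q := by
  funext i
  rw [pu, fderiv_pi h]
  rfl

theorem pv_pi {F : Fin 3 → ℝ × ℝ → ℝ} {q : ℝ × ℝ} (h : ∀ i, DifferentiableAt ℝ (F i) q) :
    pv (fun q i => F i q) q = fun i => pv (F i) q := by
  funext i
  rw [pv, fderiv_pi h]
  rfl

theorem linearIndependent_of_minor_ne_zero {a b : Fin 3 → ℝ} (h : a 0 * b 1 - a 1 * b 0 ≠ 0) :
    LinearIndependent ℝ ![a, b] := by
  rw [LinearIndependent.pair_iff]
  intro s t hst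
  have h0 := congrFun hst 0
  have h1 := congrFun hst 1
  simp only [Pi.add_apply, Pi.smul_apply, smul_eq_mul, Pi.zero_apply] at h0 h1
  constructor
  · refine (mul_eq_zero.1 ?_).resolve_right h
    linear_combination b 1 * h0 - b 0 * h1
  · refine (mul_eq_zero.1 ?_).resolve_right h
    linear_combination a 0 * h1 - a 1 * h0

theorem cbrt_ne_zero {t : ℝ} (ht : t ≠ 0) : cbrt t ≠ 0 := by
  rw [cbrt]
  split_ifs with h
  · exact neg_ne_zero.2 (Real.rpow_pos_of_pos (neg_pos.2 h) _).ne'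
  · exact (Real.rpow_pos_of_pos (lt_of_le_of_ne (not_lt.1 h) ht.symm) _).ne'

/-- Extrinsicity of the lightlike normal curvature. For a real
analytic mixed type surface `f` in L-coordinates along the lightlike set with a
generic lightlike point of the first kind at the origin, there is a real
analytic immersion `f̃` near the origin with the same first fundamental form
but with `⟨f̃_uu(0,0), f̃_uu(0,0)⟩ ≠ ⟨f_uu(0,0), f_uu(0,0)⟩`; consequently the
lightlike normal curvatures `κ_N = −∛(G_v)·θ/E_v` at the origin differ, so
`κ_N` is an extrinsic invariant. -/
theorem lightlike_normal_curvature_extrinsic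
    (U0 : Set (ℝ × ℝ)) (hU0 : IsOpen U0) (h00 : (0, 0) ∈ U0)
    (f : ℝ × ℝ → Fin 3 → ℝ) (hfan : AnalyticOnNhd ℝ f U0)
    (himm : ∀ q ∈ U0, LinearIndependent ℝ ![pu f q, pv f q])
    (E G : ℝ × ℝ → ℝ)
    (hE : E = fun q => mink (pu f q) (pu f q))
    (hG : G = fun q => mink (pv f q) (pv f q))
    (hFzero : ∀ q ∈ U0, mink (pu f q) (pv f q) = 0)
    (hEpos : ∀ q ∈ U0, 0 < E q)
    (hE1 : ∀ u : ℝ, (u, 0) ∈ U0 → E (u, 0) = 1)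
    (hG0 : ∀ u : ℝ, (u, 0) ∈ U0 → G (u, 0) = 0)
    (hGv : ∀ u : ℝ, (u, 0) ∈ U0 → pv G (u, 0) ≠ 0)
    (hEv : pv E (0, 0) ≠ 0) :
    ∃ U : Set (ℝ × ℝ), IsOpen U ∧ (0, 0) ∈ U ∧ U ⊆ U0 ∧
    ∃ ft : ℝ × ℝ → Fin 3 → ℝ,
      AnalyticOnNhd ℝ ft U ∧
      (∀ q ∈ U, LinearIndependent ℝ ![pu ft q, pv ft q]) ∧
      (∀ q ∈ U,
        mink (pu ft q) (pu ft q) = E q ∧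
        mink (pu ft q) (pv ft q) = 0 ∧
        mink (pv ft q) (pv ft q) = G q) ∧
      mink (pu (pu ft) (0, 0)) (pu (pu ft) (0, 0))
        ≠ mink (pu (pu f) (0, 0)) (pu (pu f) (0, 0)) ∧
      -- hence the lightlike normal curvatures at the origin differ
      -(cbrt (pv G (0, 0))) * mink (pu (pu ft) (0, 0)) (pu (pu ft) (0, 0))
          / pv E (0, 0)
        ≠ -(cbrt (pv G (0, 0))) * mink (pu (pu f) (0, 0)) (pu (pu f) (0, 0))
          / pv E (0, 0) := by
  have hU : U0 ∈ 𝓝 (0 : ℝ × ℝ) := hU0.mem_nhds h00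
  have af : AnalyticAt ℝ f 0 := hfan 0 h00
  have aE : AnalyticAt ℝ E 0 := by
    have h := analyticAt_pi_iff.1 (analyticAt_pu af)
    rw [hE]
    exact BiSeries.analyticAt_mink h h
  have aG : AnalyticAt ℝ G 0 := by
    have h := analyticAt_pi_iff.1 (analyticAt_pv af)
    rw [hG]
    exact BiSeries.analyticAt_mink h h
  have hax : ∀ᶠ u in 𝓝 (0 : ℝ), (u, (0 : ℝ)) ∈ U0 :=
    (Continuous.tendsto (f := fun u : ℝ => (u, (0 : ℝ))) (by fun_prop) 0).eventually hU
  obtain ⟨κ, hκ, hθ⟩ : ∃ κ : ℝ, κ ≠ 0 ∧ κ ^ 2 ≠ mink (pu (pu f) (0, 0)) (pu (pu f) (0, 0)) := by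
    by_cases h : mink (pu (pu f) (0, 0)) (pu (pu f) (0, 0)) = 1
    · exact ⟨2, two_ne_zero, by rw [h]; norm_num⟩
    · exact ⟨1, one_ne_zero, by rw [one_pow]; exact Ne.symm h⟩
  obtain ⟨F, aF, hF, hFu, hFv, hFuu⟩ := BiSeries.exists_isometric_germ aE aG
    (hax.mono hE1) (hax.mono hG0) hEv hκ
  set ft : ℝ × ℝ → Fin 3 → ℝ := fun q i => F i q with hft
  have aft : AnalyticAt ℝ ft 0 := analyticAt_pi_iff.2 aF
  have hd : ∀ᶠ q in 𝓝 (0 : ℝ × ℝ), ∀ i, DifferentiableAt ℝ (F i) q :=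
    eventually_all.2 fun i => eventually_differentiableAt (aF i)
  have hpu : pu ft =ᶠ[𝓝 0] fun q i => pu (F i) q := hd.mono fun q hq => pu_pi hq
  have hpv : pv ft =ᶠ[𝓝 0] fun q i => pv (F i) q := hd.mono fun q hq => pv_pi hq
  have hpuu : pu (pu ft) 0 = ![-κ, 0, 0] := by
    rw [(pu_congr hpu).eq_of_nhds, pu_pi fun i => (analyticAt_pu (aF i)).differentiableAt]
    exact funext hFuu
  have hθt : mink (pu (pu ft) (0, 0)) (pu (pu ft) (0, 0)) = κ ^ 2 := by
    rw [Prod.mk_zero_zero, hpuu]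
    simp [mink]
    ring
  have hminor : ∀ᶠ q in 𝓝 (0 : ℝ × ℝ),
      pu (F 0) q * pv (F 1) q - pu (F 1) q * pv (F 0) q ≠ 0 := by
    have hu := fun i => (analyticAt_pu (aF i)).continuousAt
    have hv := fun i => (analyticAt_pv (aF i)).continuousAt
    refine (((hu 0).mul (hv 1)).sub ((hu 1).mul (hv 0))).eventually_ne ?_
    change pu (F 0) 0 * pv (F 1) 0 - pu (F 1) 0 * pv (F 0) 0 ≠ 0
    rw [hFu, hFu, hFv, hFv]
    simpa using ⟨hEv, hκ⟩
  have hall : ∀ᶠ q in 𝓝 (0 : ℝ × ℝ), q ∈ U0 ∧ AnalyticAt ℝ ft q ∧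
      LinearIndependent ℝ ![pu ft q, pv ft q] ∧ mink (pu ft q) (pu ft q) = E q ∧
      mink (pu ft q) (pv ft q) = 0 ∧ mink (pv ft q) (pv ft q) = G q := by
    filter_upwards [hU, aft.eventually_analyticAt, hpu, hpv, hminor, hF] with q h1 h2 h3 h4 h5 h6
    rw [h3, h4]
    exact ⟨h1, h2, linearIndependent_of_minor_ne_zero h5, h6⟩
  obtain ⟨U, hUsub, hUo, hU0'⟩ := mem_nhds_iff.1 hall
  refine ⟨U, hUo, hU0', fun q hq => (hUsub hq).1, ft, fun q hq => (hUsub hq).2.1,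
    fun q hq => (hUsub hq).2.2.1, fun q hq => (hUsub hq).2.2.2, ?_, ?_⟩
  · rwa [hθt]
  · rw [hθt, Ne, div_left_inj' hEv, mul_right_inj' (neg_ne_zero.2 (cbrt_ne_zero (hGv 0 h00)))]
    exact hθ
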